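/- arXiv:1211.4390 — 5 statements merged into one kernel-verified Lean document; each statement's English description precedes it below -/
import Mathlib

section
/- Every infinite-dimensional separable Banach space over ℝ or ℂ admits a hypercyclic bounded linear operator. -/
open Filter Topology

/-- A continuous linear operator `T` is hypercyclic if some vector has dense orbit. -/
def Hypercyclic {𝕜 X : Type*} [Semiring 𝕜] [TopologicalSpace X] [AddCommMonoid X]
    [Module 𝕜 X] (T : X →L[𝕜] X) : Prop :=
  ∃ x : X, Dense (Set.range fun n : ℕ => (T ^ n) x)

/-- With `g i = (v i, f i)`: `v 0, …, v (n - 1)` and `f 0, …, f (n - 1)` are biorthogonal, the first `n` terms of `y` are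
captured by the spans of the `v i`, and the rank-one operators sending `v k` to
`∑ j < k, (k.choose j) • v j` have norms at most `2⁻ᵏ`. -/
structure BinomialSystem {𝕜 E : Type*} [RCLike 𝕜] [NormedAddCommGroup E] [NormedSpace 𝕜 E]
    (y : ℕ → E) (n : ℕ) (g : ℕ → E × (E →L[𝕜] 𝕜)) : Prop where
  self : ∀ i < n, (g i).2 (g i).1 = 1
  ne : ∀ i < n, ∀ j < n, i ≠ j → (g i).2 (g j).1 = 0
  mem_span : ∀ i < n, y i ∈ Submodule.span 𝕜 ((fun j => (g j).1) '' Set.Iic i)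
  norm_le : ∀ k < n, ‖(g k).2‖ * ‖∑ j ∈ Finset.range k, (k.choose j : 𝕜) • (g j).1‖ ≤ (1 / 2) ^ k

/-- A property of finite initial segments which can always be extended by one term holds for all
initial segments of some infinite sequence. -/
theorem exists_seq_of_forall_extend {α : Type*} [Nonempty α] (Q : ℕ → (ℕ → α) → Prop)
    (congr : ∀ n g g', (∀ i < n, g i = g' i) → Q n g → Q n g')
    (zero : ∀ g, Q 0 g) (extend : ∀ n g, Q n g → ∃ a, Q (n + 1) (Function.update g n a)) :
    ∃ g, ∀ n, Q n g := by
  choose a ha using extend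
  let s : (n : ℕ) → {g : ℕ → α // Q n g} := fun n => Nat.rec ⟨fun _ => Classical.arbitrary α, zero _⟩
    (fun n g => ⟨Function.update g.1 n (a n g.1 g.2), ha n g.1 g.2⟩) n
  have hs : ∀ n, (s (n + 1)).1 = Function.update (s n).1 n (a n (s n).1 (s n).2) := fun n => rfl
  have key : ∀ n i, i < n → (s n).1 i = (s (i + 1)).1 i := by
    intro n
    induction n with
    | zero => intro i hi; omega
    | succ n ih =>
      intro i hi
      rcases Nat.lt_succ_iff_lt_or_eq.mp hi with h | rfl
      · rw [hs, Function.update_of_ne h.ne, ih i h]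
      · rfl
  exact ⟨fun i => (s (i + 1)).1 i, fun n => congr n _ _ (key n) (s n).2⟩

section Construction

variable {𝕜 E : Type*} [RCLike 𝕜] [NormedAddCommGroup E] [NormedSpace 𝕜 E]

theorem BinomialSystem.congr {y : ℕ → E} {n : ℕ} {g g' : ℕ → E × (E →L[𝕜] 𝕜)}
    (h : ∀ i < n, g i = g' i) (hg : BinomialSystem y n g) : BinomialSystem y n g' where
  self i hi := by rw [← h i hi]; exact hg.self i hi
  ne i hi j hj hij := by rw [← h i hi, ← h j hj]; exact hg.ne i hi j hj hij
  mem_span i hi := by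
    have : (fun j => (g' j).1) '' Set.Iic i = (fun j => (g j).1) '' Set.Iic i :=
      Set.image_congr fun j hj => by rw [h j (lt_of_le_of_lt hj hi)]
    rw [this]
    exact hg.mem_span i hi
  norm_le k hk := by
    have : ∑ j ∈ Finset.range k, (k.choose j : 𝕜) • (g' j).1
        = ∑ j ∈ Finset.range k, (k.choose j : 𝕜) • (g j).1 :=
      Finset.sum_congr rfl fun j hj => by rw [h j ((Finset.mem_range.mp hj).trans hk)]
    rw [this, ← h k hk]
    exact hg.norm_le k hk

theorem exists_notMem_span_of_finite (h : ¬FiniteDimensional 𝕜 E) {s : Set E} (hs : s.Finite) :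
    ∃ z, z ∉ Submodule.span 𝕜 s := by
  by_contra! H
  exact h ⟨⟨hs.toFinset, by rw [hs.coe_toFinset]; exact eq_top_iff.mpr fun z _ => H z⟩⟩

theorem BinomialSystem.exists_update (h : ¬FiniteDimensional 𝕜 E) {y : ℕ → E} {n : ℕ}
    {g : ℕ → E × (E →L[𝕜] 𝕜)} (hg : BinomialSystem y n g) :
    ∃ a, BinomialSystem y (n + 1) (Function.update g n a) := by
  set S : Submodule 𝕜 E := Submodule.span 𝕜 ((fun j => (g j).1) '' Set.Iio n) with hS
  have hmem : ∀ j < n, (g j).1 ∈ S := fun j hj => Submodule.subset_span ⟨j, hj, rfl⟩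
  obtain ⟨z, hz, hyz⟩ : ∃ z, z ∉ S ∧ y n ∈ S ⊔ Submodule.span 𝕜 {z} := by
    by_cases hy : y n ∈ S
    · obtain ⟨z, hz⟩ := exists_notMem_span_of_finite h
        ((Set.finite_Iio n).image fun j => (g j).1)
      exact ⟨z, hz, Submodule.mem_sup_left hy⟩
    · exact ⟨y n, hy, Submodule.mem_sup_right (Submodule.mem_span_singleton_self _)⟩
  set p : E := ∑ i ∈ Finset.range n, (g i).2 z • (g i).1 with hp
  have hpS : p ∈ S := Submodule.sum_mem _ fun i hi =>
    Submodule.smul_mem _ _ (hmem i (Finset.mem_range.mp hi))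
  set x : E := z - p with hx
  have hx0 : x ≠ 0 := fun h0 => hz (by rw [sub_eq_zero.mp h0]; exact hpS)
  have hfx : ∀ j < n, (g j).2 x = 0 := by
    intro j hj
    rw [hx, map_sub, hp, map_sum, Finset.sum_eq_single_of_mem j (Finset.mem_range.mpr hj)]
    · simp [hg.self j hj]
    · intro i hi hij
      simp [hg.ne j hj i (Finset.mem_range.mp hi) hij.symm]
  obtain ⟨φ, -, hφ⟩ := exists_dual_vector 𝕜 x (norm_ne_zero_iff.mpr hx0)
  have hφ0 : φ x ≠ 0 := by rw [hφ]; simpa using hx0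
  set ψ : E →L[𝕜] 𝕜 := φ - ∑ i ∈ Finset.range n, φ (g i).1 • (g i).2 with hψ
  have hψx : ψ x = φ x := by
    have : ∑ i ∈ Finset.range n, φ (g i).1 * (g i).2 x = 0 :=
      Finset.sum_eq_zero fun i hi => by rw [hfx i (Finset.mem_range.mp hi), mul_zero]
    simp [hψ, this]
  have hψv : ∀ j < n, ψ (g j).1 = 0 := by
    intro j hj
    have : ∑ i ∈ Finset.range n, φ (g i).1 * (g i).2 (g j).1 = φ (g j).1 := by
      rw [Finset.sum_eq_single_of_mem j (Finset.mem_range.mpr hj)]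
      · simp [hg.self j hj]
      · intro i hi hij
        simp [hg.ne i (Finset.mem_range.mp hi) j hj hij]
    simp [hψ, this]
  set w : E := ∑ j ∈ Finset.range n, (n.choose j : 𝕜) • (g j).1 with hw
  obtain ⟨c, hc, hcle⟩ : ∃ c : 𝕜, c ≠ 0 ∧ ‖c • ψ‖ * ‖w‖ ≤ (1 / 2) ^ n := by
    have ht : Tendsto (fun c : 𝕜 => ‖c • ψ‖ * ‖w‖) (𝓝[≠] 0) (𝓝 (‖(0 : 𝕜) • ψ‖ * ‖w‖)) :=
      (Continuous.tendsto (by fun_prop) 0).mono_left nhdsWithin_le_nhds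
    have hpos : ‖(0 : 𝕜) • ψ‖ * ‖w‖ < (1 / 2 : ℝ) ^ n := by
      have h0 : (0 : 𝕜) • ψ = 0 := zero_smul 𝕜 ψ
      rw [h0, norm_zero, zero_mul]
      positivity
    obtain ⟨c, hc, hc0⟩ := ((ht.eventually_lt_const hpos).and self_mem_nhdsWithin).exists
    exact ⟨c, hc0, hc.le⟩
  set G := Function.update g n ((c * φ x)⁻¹ • x, c • ψ) with hG
  have hGn : G n = ((c * φ x)⁻¹ • x, c • ψ) := Function.update_self ..
  have hGi : ∀ i < n, G i = g i := fun i hi => Function.update_of_ne hi.ne ..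
  have hold : BinomialSystem y n G := hg.congr fun i hi => (hGi i hi).symm
  refine ⟨((c * φ x)⁻¹ • x, c • ψ), ?_⟩
  rw [← hG]
  refine ⟨?_, ?_, ?_, ?_⟩
  · intro i hi
    rcases Nat.lt_succ_iff_lt_or_eq.mp hi with hi | rfl
    · exact hold.self i hi
    · rw [hGn]
      simp only [map_smul, smul_apply, hψx, smul_eq_mul]
      field_simp
  · intro i hi j hj hij
    rcases Nat.lt_succ_iff_lt_or_eq.mp hi with hi | rfl <;>
      rcases Nat.lt_succ_iff_lt_or_eq.mp hj with hj | rfl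
    · exact hold.ne i hi j hj hij
    · rw [hGn, hGi i hi]
      simp [hfx i hi]
    · rw [hGn, hGi j hj]
      simp [hψv j hj]
    · exact absurd rfl hij
  · intro i hi
    rcases Nat.lt_succ_iff_lt_or_eq.mp hi with hi | rfl
    · exact hold.mem_span i hi
    · have hle : S ≤ Submodule.span 𝕜 ((fun j => (G j).1) '' Set.Iic i) := by
        rw [hS, Submodule.span_le]
        rintro _ ⟨j, hj, rfl⟩
        refine Submodule.subset_span ⟨j, Set.mem_Iic.mpr (le_of_lt hj), ?_⟩
        simp only [hGi j hj]
      refine (sup_le hle ?_ : S ⊔ Submodule.span 𝕜 {z} ≤ _) hyz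
      rw [Submodule.span_singleton_le_iff_mem]
      have hxz : z = (c * φ x) • (G i).1 + p := by
        rw [hGn, smul_inv_smul₀ (mul_ne_zero hc hφ0), hx, sub_add_cancel]
      rw [hxz]
      exact Submodule.add_mem _
        (Submodule.smul_mem _ _ (Submodule.subset_span ⟨i, Set.mem_Iic.mpr le_rfl, rfl⟩)) (hle hpS)
  · intro k hk
    rcases Nat.lt_succ_iff_lt_or_eq.mp hk with hk | rfl
    · exact hold.norm_le k hk
    · rw [hGn, Finset.sum_congr rfl fun j hj => by rw [hGi j (Finset.mem_range.mp hj)]]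
      exact hcle

theorem exists_binomialSystem (h : ¬FiniteDimensional 𝕜 E) (y : ℕ → E) :
    ∃ g : ℕ → E × (E →L[𝕜] 𝕜), ∀ n, BinomialSystem y n g :=
  exists_seq_of_forall_extend (BinomialSystem y) (fun _ _ _ h hg => hg.congr h)
    (fun _ => ⟨by simp, by simp, by simp, by simp⟩) fun _ _ hg => hg.exists_update h

open Polynomial in
/-- Some bounded operator on `E` is a quasi-factor of the unit translation of polynomials. -/
theorem exists_operator_intertwining_translation [CompleteSpace E]
    [TopologicalSpace.SeparableSpace E] (h : ¬FiniteDimensional 𝕜 E) :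
    ∃ (T : E →L[𝕜] E) (Φ : 𝕜[X] →ₗ[𝕜] E), DenseRange Φ ∧
      ∀ p : 𝕜[X], T (Φ p) = Φ (p.comp (X + 1)) := by
  obtain ⟨g, hg⟩ := exists_binomialSystem h (TopologicalSpace.denseSeq E)
  set v : ℕ → E := fun k => (g k).1
  set f : ℕ → E →L[𝕜] 𝕜 := fun k => (g k).2
  set w : ℕ → E := fun k => ∑ j ∈ Finset.range k, (k.choose j : 𝕜) • v j
  let Φ : 𝕜[X] →ₗ[𝕜] E := (basisMonomials 𝕜).constr 𝕜 v
  have hΦ : ∀ k, Φ (X ^ k) = v k := by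
    intro k
    have := (basisMonomials 𝕜).constr_basis 𝕜 v k
    rwa [coe_basisMonomials, show (fun s => monomial s (1 : 𝕜)) k = monomial k 1 from rfl,
      monomial_one_right_eq_X_pow] at this
  have hsum : Summable fun k => (f k).smulRight (w k) := by
    refine Summable.of_norm_bounded summable_geometric_two fun k => ?_
    rw [ContinuousLinearMap.norm_smulRight_apply]
    exact (hg (k + 1)).norm_le k k.lt_succ_self
  let T : E →L[𝕜] E := 1 + ∑' k, (f k).smulRight (w k)
  have hT : ∀ k, T (v k) = v k + w k := by
    intro k
    have h1 : (∑' i, (f i).smulRight (w i)) (v k) = ∑' i, f i (v k) • w i := by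
      have := (ContinuousLinearMap.apply 𝕜 E (v k)).map_tsum hsum
      simpa using this
    have h2 : ∑' i, f i (v k) • w i = w k := by
      rw [tsum_eq_single k]
      · rw [show f k (v k) = 1 from (hg (k + 1)).self k k.lt_succ_self, one_smul]
      · intro i hi
        rw [show f i (v k) = 0 from
          (hg (max i k + 1)).ne i (by omega) k (by omega) hi, zero_smul]
    simp [T, h1, h2]
  refine ⟨T, Φ, ?_, ?_⟩
  · refine (TopologicalSpace.denseRange_denseSeq E).mono ?_
    rintro _ ⟨n, rfl⟩
    have hle : Submodule.span 𝕜 (v '' Set.Iic n) ≤ LinearMap.range Φ := by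
      rw [Submodule.span_le]
      rintro _ ⟨j, -, rfl⟩
      exact ⟨X ^ j, hΦ j⟩
    exact hle ((hg (n + 1)).mem_span n n.lt_succ_self)
  · intro p
    induction p using Polynomial.induction_on' with
    | add p q hp hq => simp [hp, hq]
    | monomial k a =>
      rw [← C_mul_X_pow_eq_monomial, ← smul_eq_C_mul, map_smul, map_smul, smul_comp, map_smul,
        hΦ, hT, X_pow_comp, add_pow, Finset.sum_range_succ, map_add, map_sum]
      congr 1
      rw [add_comm]
      congr 1
      · refine Finset.sum_congr rfl fun j _ => ?_
        rw [one_pow, mul_one, mul_comm, ← map_natCast C, ← smul_eq_C_mul, map_smul, hΦ]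
      · simp [hΦ]

end Construction

section Translation

open Polynomial

variable {𝕜 E : Type*} [RCLike 𝕜] [NormedAddCommGroup E] [NormedSpace 𝕜 E]

/-- Families of polynomials which depend polynomially on `1 / (n + 1)`. -/
noncomputable def polynomialInRecip (𝕜 : Type*) [RCLike 𝕜] : Subalgebra 𝕜[X] (ℕ → 𝕜[X]) :=
  Algebra.adjoin 𝕜[X] {fun n : ℕ => C ((n : 𝕜) + 1)⁻¹}

theorem recip_mem_polynomialInRecip :
    (fun n : ℕ => C ((n : 𝕜) + 1)⁻¹) ∈ polynomialInRecip 𝕜 :=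
  Algebra.subset_adjoin rfl

theorem const_mem_polynomialInRecip (p : 𝕜[X]) : (fun _ => p) ∈ polynomialInRecip 𝕜 :=
  (polynomialInRecip 𝕜).algebraMap_mem p

theorem comp_mem_polynomialInRecip (g : 𝕜[X]) {F : ℕ → 𝕜[X]} (hF : F ∈ polynomialInRecip 𝕜) :
    (fun n => g.comp (F n)) ∈ polynomialInRecip 𝕜 := by
  induction g using Polynomial.induction_on' with
  | add p q hp hq => simpa using! add_mem hp hq
  | monomial k a =>
    simp only [monomial_comp]
    exact mul_mem (const_mem_polynomialInRecip (C a)) (pow_mem hF k)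

theorem tendsto_recip_smul_of_mem_polynomialInRecip (Φ : 𝕜[X] →ₗ[𝕜] E) {F : ℕ → 𝕜[X]}
    (hF : F ∈ polynomialInRecip 𝕜) :
    Tendsto (fun n : ℕ => Φ (C ((n : 𝕜) + 1)⁻¹ * F n)) atTop (𝓝 0) := by
  have hε : Tendsto (fun n : ℕ => ((n : 𝕜) + 1)⁻¹) atTop (𝓝 0) := by
    simpa using tendsto_one_div_add_atTop_nhds_zero_nat (𝕜 := 𝕜)
  rw [polynomialInRecip, Algebra.adjoin_singleton_eq_range_aeval] at hF
  obtain ⟨Q, rfl⟩ := hF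
  induction Q using Polynomial.induction_on' with
  | add p q hp hq => simpa [mul_add] using hp.add hq
  | monomial k a =>
    have : ∀ n : ℕ, Φ (C ((n : 𝕜) + 1)⁻¹ *
        (aeval (fun n : ℕ => C ((n : 𝕜) + 1)⁻¹) (monomial k a) : ℕ → 𝕜[X]) n)
        = (((n : 𝕜) + 1)⁻¹) ^ (k + 1) • Φ a := by
      intro n
      rw [← map_smul, smul_eq_C_mul, aeval_monomial, C_pow]
      congr 1
      simp only [Pi.mul_apply, Pi.pow_apply, Pi.algebraMap_apply, Algebra.algebraMap_self,
        RingHom.id_apply]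
      ring
    have h0 := (hε.pow (k + 1)).smul_const (Φ a)
    rw [zero_pow k.succ_ne_zero, zero_smul] at h0
    exact h0.congr fun n => (this n).symm

/-- If `deg b ≤ N`, then `(n + 1) ^ (-N) * b (t + s (n + 1))` depends polynomially on
`1 / (n + 1)`. -/
theorem recip_pow_mul_comp_mem_polynomialInRecip (s : 𝕜) {N : ℕ} {b : 𝕜[X]}
    (hb : b.natDegree ≤ N) :
    (fun n : ℕ => C ((n : 𝕜) + 1)⁻¹ ^ N * b.comp (X + C (s * ((n : 𝕜) + 1))))
      ∈ polynomialInRecip 𝕜 := by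
  have key : (fun n : ℕ => C ((n : 𝕜) + 1)⁻¹ ^ N * b.comp (X + C (s * ((n : 𝕜) + 1))))
      = ∑ i ∈ Finset.range (N + 1), (fun _ => C (b.coeff i)) *
        ((fun n : ℕ => C ((n : 𝕜) + 1)⁻¹) ^ (N - i) *
        ((fun n : ℕ => C ((n : 𝕜) + 1)⁻¹) * (fun _ => X) + (fun _ => C s)) ^ i) := by
    funext n
    have hn : (n : 𝕜) + 1 ≠ 0 := Nat.cast_add_one_ne_zero n
    have hC : C ((n : 𝕜) + 1)⁻¹ * C (s * ((n : 𝕜) + 1)) = C s := by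
      rw [← C_mul]; congr 1; field_simp
    rw [comp_eq_sum_left, sum_over_range' _ (by simp) (N + 1) (by omega), Finset.mul_sum,
      Finset.sum_apply]
    refine Finset.sum_congr rfl fun i hi => ?_
    have hiN : i ≤ N := by simpa [Nat.lt_succ_iff] using hi
    simp only [Pi.mul_apply, Pi.pow_apply, Pi.add_apply]
    rw [← hC, ← mul_add, mul_pow]
    conv_lhs => rw [← Nat.sub_add_cancel hiN, pow_add]
    ring
  rw [key]
  refine sum_mem fun i _ => mul_mem (const_mem_polynomialInRecip _)
    (mul_mem (pow_mem recip_mem_polynomialInRecip _) (pow_mem (add_mem (mul_mem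
      recip_mem_polynomialInRecip (const_mem_polynomialInRecip _))
      (const_mem_polynomialInRecip _)) _))

theorem tendsto_comp_sub_mul (Φ : 𝕜[X] →ₗ[𝕜] E) (s : 𝕜) {N : ℕ} (a g : 𝕜[X]) {b : 𝕜[X]}
    (hb : b.natDegree ≤ N) :
    Tendsto (fun n : ℕ => Φ ((b.comp (X + C (s * ((n : 𝕜) + 1))) - a) *
      (X ^ (N + 1) * g).comp (C ((n : 𝕜) + 1)⁻¹ * X))) atTop (𝓝 0) := by
  have hε := recip_mem_polynomialInRecip (𝕜 := 𝕜)
  have hmem := mul_mem (mul_mem (sub_mem (recip_pow_mul_comp_mem_polynomialInRecip s hb)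
    (mul_mem (pow_mem hε N) (const_mem_polynomialInRecip a)))
    (const_mem_polynomialInRecip (X ^ (N + 1))))
    (comp_mem_polynomialInRecip g (mul_mem hε (const_mem_polynomialInRecip X)))
  refine (tendsto_recip_smul_of_mem_polynomialInRecip Φ hmem).congr fun n => ?_
  congr 1
  simp only [Pi.mul_apply, Pi.sub_apply, Pi.pow_apply, mul_comp, X_pow_comp]
  ring

/-- Any two polynomials are approximately joined by a large translation. -/
theorem exists_tendsto_comp_translation (Φ : 𝕜[X] →ₗ[𝕜] E) (p q : 𝕜[X]) :
    ∃ u : ℕ → 𝕜[X], Tendsto (fun n => Φ (u n)) atTop (𝓝 (Φ p)) ∧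
      Tendsto (fun n => Φ ((u n).comp (X + C ((n : 𝕜) + 1)))) atTop (𝓝 (Φ q)) := by
  set N := max p.natDegree q.natDegree
  have hcop : IsCoprime ((X : 𝕜[X]) ^ (N + 1)) ((X - 1) ^ (N + 1)) :=
    IsCoprime.pow ⟨1, -1, by ring⟩
  obtain ⟨a, b, hab⟩ := hcop
  set e : 𝕜[X] := b * (X - 1) ^ (N + 1)
  have he : e = 1 - X ^ (N + 1) * a := by rw [← hab]; ring
  have he' : e.comp (X + 1) = X ^ (N + 1) * b.comp (X + 1) := by
    simp [e, mul_comm]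
  clear_value e
  refine ⟨fun n => p * e.comp (C ((n : 𝕜) + 1)⁻¹ * X) +
    q.comp (X - C ((n : 𝕜) + 1)) * (1 - e.comp (C ((n : 𝕜) + 1)⁻¹ * X)), ?_, ?_⟩
  · have := tendsto_comp_sub_mul Φ (-1) p a (le_max_right _ _ : q.natDegree ≤ N)
    rw [← tendsto_sub_nhds_zero_iff]
    refine this.congr fun n => ?_
    rw [← map_sub]
    congr 1
    rw [he, neg_one_mul, C_neg, ← sub_eq_add_neg]
    simp only [sub_comp, one_comp]
    ring
  · have := tendsto_comp_sub_mul Φ 1 q (b.comp (X + 1)) (le_max_left _ _ : p.natDegree ≤ N)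
    rw [← tendsto_sub_nhds_zero_iff]
    refine this.congr fun n => ?_
    rw [← map_sub]
    congr 1
    have hn : (n : 𝕜) + 1 ≠ 0 := Nat.cast_add_one_ne_zero n
    have hC : C ((n : 𝕜) + 1)⁻¹ * C ((n : 𝕜) + 1) = 1 := by
      rw [← C_mul, inv_mul_cancel₀ hn, C_1]
    have h1 : (e.comp (C ((n : 𝕜) + 1)⁻¹ * X)).comp (X + C ((n : 𝕜) + 1))
        = (e.comp (X + 1)).comp (C ((n : 𝕜) + 1)⁻¹ * X) := by
      rw [comp_assoc, comp_assoc]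
      congr 1
      simp only [mul_comp, C_comp, X_comp, add_comp, one_comp, mul_add, hC]
    have h2 : (q.comp (X - C ((n : 𝕜) + 1))).comp (X + C ((n : 𝕜) + 1)) = q := by
      rw [comp_assoc]
      simp only [sub_comp, X_comp, C_comp, add_sub_cancel_right, comp_X]
    rw [← he', one_mul, add_comp, mul_comp, mul_comp, sub_comp, h1, h2, one_comp]
    ring

end Translation

/-- Birkhoff's transitivity theorem. -/
theorem hypercyclic_of_transitive {𝕜 X : Type*} [RCLike 𝕜]
    [NormedAddCommGroup X] [NormedSpace 𝕜 X] [CompleteSpace X]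
    [TopologicalSpace.SeparableSpace X] (T : X →L[𝕜] X)
    (hT : ∀ U V : Set X, IsOpen U → U.Nonempty → IsOpen V → V.Nonempty →
      ∃ n : ℕ, ∃ x ∈ U, (T ^ n) x ∈ V) : Hypercyclic T := by
  have := UniformSpace.secondCountable_of_separable X
  set B := TopologicalSpace.countableBasis X
  have hB := TopologicalSpace.isBasis_countableBasis X
  have hd : Dense (⋂ V ∈ B, ⋃ n : ℕ, (T ^ n) ⁻¹' V) := by
    refine dense_biInter_of_isOpen
      (fun V hV => isOpen_iUnion fun n => (hB.isOpen hV).preimage (T ^ n).continuous)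
      (TopologicalSpace.countable_countableBasis X) fun V hV => ?_
    refine dense_iff_inter_open.mpr fun U hU hUne => ?_
    obtain ⟨n, x, hxU, hxV⟩ := hT U V hU hUne (hB.isOpen hV)
      (TopologicalSpace.nonempty_of_mem_countableBasis hV)
    exact ⟨x, hxU, Set.mem_iUnion.mpr ⟨n, hxV⟩⟩
  obtain ⟨x, hx⟩ := hd.nonempty
  refine ⟨x, hB.dense_iff.mpr fun V hV _ => ?_⟩
  obtain ⟨n, hn⟩ := Set.mem_iUnion.mp (Set.mem_iInter₂.mp hx V hV)
  exact ⟨_, hn, n, rfl⟩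

/-- Ansari's theorem: every infinite-dimensional separable Banach space over `ℝ` or `ℂ`
admits a hypercyclic bounded linear operator. -/
theorem exists_hypercyclic_operator {𝕜 X : Type*} [RCLike 𝕜]
    [NormedAddCommGroup X] [NormedSpace 𝕜 X] [CompleteSpace X]
    [TopologicalSpace.SeparableSpace X] (h : ¬FiniteDimensional 𝕜 X) :
    ∃ T : X →L[𝕜] X, Hypercyclic T := by
  obtain ⟨T, Φ, hΦ, hTΦ⟩ := exists_operator_intertwining_translation h
  have hpow : ∀ (n : ℕ) (p : Polynomial 𝕜),
      (T ^ n) (Φ p) = Φ (p.comp (Polynomial.X + Polynomial.C (n : 𝕜))) := by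
    intro n
    induction n with
    | zero => intro p; simp
    | succ n ih =>
      intro p
      rw [pow_succ', mul_apply_eq_comp, ih, hTΦ, Polynomial.comp_assoc]
      simp [add_assoc, add_comm]
  refine ⟨T, hypercyclic_of_transitive T fun U V hU hUne hV hVne => ?_⟩
  obtain ⟨p, hp⟩ := hΦ.exists_mem_open hU hUne
  obtain ⟨q, hq⟩ := hΦ.exists_mem_open hV hVne
  obtain ⟨u, hu, hu'⟩ := exists_tendsto_comp_translation Φ p q
  obtain ⟨n, hnU, hnV⟩ := ((hu.eventually (hU.mem_nhds hp)).and
    (hu'.eventually (hV.mem_nhds hq))).exists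
  refine ⟨n + 1, Φ (u n), hnU, ?_⟩
  rw [hpow]
  exact_mod_cast hnV
end

section
/- There exist a separable infinite-dimensional Banach space X and a hypercyclic bounded linear operator T on X such that the direct sum T ⊕ T, acting on X × X by (f,g) ↦ (Tf, Tg), is not hypercyclic on X × X (with the product norm topology). -/
open Filter Topology

open Polynomial

/-- The `ℓ¹` norm of the coefficients of a polynomial, with weight `2 ^ n` on `X ^ n`. -/
noncomputable def weightedNorm (p : ℂ[X]) : ℝ := p.sum fun n a => ‖a‖ * 2 ^ n

theorem weightedNorm_eq_sum_range (p : ℂ[X]) {N : ℕ} (h : p.natDegree < N) :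
    weightedNorm p = ∑ n ∈ Finset.range N, ‖p.coeff n‖ * 2 ^ n :=
  p.sum_over_range' (by simp) N h

theorem weightedNorm_nonneg (p : ℂ[X]) : 0 ≤ weightedNorm p :=
  Finset.sum_nonneg fun _ _ => by positivity

theorem weightedNorm_C_mul_X_pow (a : ℂ) (n : ℕ) :
    weightedNorm (C a * X ^ n) = ‖a‖ * 2 ^ n := by
  rw [weightedNorm, C_mul_X_pow_eq_monomial, sum_monomial_index _ _ (by simp)]

theorem weightedNorm_zero : weightedNorm 0 = 0 := by simp [weightedNorm]

theorem weightedNorm_add_le (p q : ℂ[X]) :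
    weightedNorm (p + q) ≤ weightedNorm p + weightedNorm q := by
  set N := max p.natDegree q.natDegree + 1
  have hp : p.natDegree < N := by omega
  have hq : q.natDegree < N := by omega
  have hpq : (p + q).natDegree < N := (natDegree_add_le p q).trans_lt (by omega)
  rw [weightedNorm_eq_sum_range _ hp, weightedNorm_eq_sum_range _ hq,
    weightedNorm_eq_sum_range _ hpq, ← Finset.sum_add_distrib]
  refine Finset.sum_le_sum fun n _ => ?_
  rw [coeff_add, ← add_mul]
  gcongr
  exact norm_add_le _ _

theorem weightedNorm_neg (p : ℂ[X]) : weightedNorm (-p) = weightedNorm p := by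
  rw [weightedNorm_eq_sum_range p (Nat.lt_succ_self _),
    weightedNorm_eq_sum_range (-p) (N := p.natDegree.succ) (by simp)]
  simp

theorem weightedNorm_sum_le {ι : Type*} (s : Finset ι) (f : ι → ℂ[X]) :
    weightedNorm (∑ i ∈ s, f i) ≤ ∑ i ∈ s, weightedNorm (f i) :=
  Finset.le_sum_of_subadditive weightedNorm weightedNorm_zero.le weightedNorm_add_le s f

theorem weightedNorm_C_mul_X_pow_mul_le (a : ℂ) (n : ℕ) (q : ℂ[X]) :
    weightedNorm (C a * X ^ n * q) ≤ ‖a‖ * 2 ^ n * weightedNorm q := by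
  conv_lhs => rw [q.as_sum_range_C_mul_X_pow, Finset.mul_sum]
  refine (weightedNorm_sum_le _ _).trans ?_
  rw [weightedNorm_eq_sum_range q (Nat.lt_succ_self _), Finset.mul_sum]
  refine Finset.sum_le_sum fun m _ => ?_
  have : C a * X ^ n * (C (q.coeff m) * X ^ m) = C (a * q.coeff m) * X ^ (n + m) := by
    rw [C_mul, pow_add]; ring
  rw [this, weightedNorm_C_mul_X_pow, norm_mul, pow_add]
  apply le_of_eq
  ring

theorem weightedNorm_mul_le (p q : ℂ[X]) :
    weightedNorm (p * q) ≤ weightedNorm p * weightedNorm q := by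
  conv_lhs => rw [p.as_sum_range_C_mul_X_pow, Finset.sum_mul]
  refine (weightedNorm_sum_le _ _).trans ?_
  rw [weightedNorm_eq_sum_range p (Nat.lt_succ_self _), Finset.sum_mul]
  exact Finset.sum_le_sum fun n _ => weightedNorm_C_mul_X_pow_mul_le _ _ _

theorem weightedNorm_X_pow (n : ℕ) : weightedNorm (X ^ n) = 2 ^ n := by
  simpa using weightedNorm_C_mul_X_pow 1 n

/-- The sequence determined by the value `1` at `0` and the recurrence with coefficients `A n`. -/
noncomputable def recSeq (A : ℕ → ℂ[X]) (n : ℕ) : ℂ :=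
  if n = 0 then 1 else ∑ j : Fin n, (A n).coeff j * recSeq A j
decreasing_by exact j.2

theorem exists_linearMap_X_pow_eq (A : ℕ → ℂ[X]) (hdeg : ∀ n ≠ 0, (A n).natDegree < n)
    (hA : ∀ n ≠ 0, weightedNorm (A n) ≤ 2 ^ n) :
    ∃ φ : ℂ[X] →ₗ[ℂ] ℂ, φ 1 = 1 ∧ (∀ n ≠ 0, φ (X ^ n) = φ (A n)) ∧
      ∀ p, ‖φ p‖ ≤ weightedNorm p := by
  let φ : ℂ[X] →ₗ[ℂ] ℂ := lsum fun n => LinearMap.mulRight ℂ (recSeq A n)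
  have hφ (p : ℂ[X]) {N : ℕ} (h : p.natDegree < N) :
      φ p = ∑ j ∈ Finset.range N, p.coeff j * recSeq A j :=
    p.sum_over_range' (by simp) N h
  have hX (n : ℕ) : φ (X ^ n) = recSeq A n := by
    rw [hφ (N := n + 1) _ (by simp), Finset.sum_eq_single n] <;> simp +contextual [coeff_X_pow]
  have hrec (n : ℕ) (hn : n ≠ 0) : recSeq A n = φ (A n) := by
    rw [hφ _ (hdeg n hn), recSeq, if_neg hn, Finset.sum_range]
  have hbound (n : ℕ) : ‖recSeq A n‖ ≤ 2 ^ n := by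
    induction n using Nat.strong_induction_on with
    | _ n ih =>
      rcases eq_or_ne n 0 with rfl | hn
      · simp [recSeq]
      · rw [hrec n hn, hφ _ (hdeg n hn)]
        refine le_trans ?_ (hA n hn)
        rw [weightedNorm_eq_sum_range _ (hdeg n hn)]
        refine norm_sum_le_of_le _ fun j hj => ?_
        rw [norm_mul]
        gcongr
        exact ih j (Finset.mem_range.1 hj)
  refine ⟨φ, ?_, fun n hn => by rw [hX, hrec n hn], fun p => ?_⟩
  · simpa [recSeq] using hX 0
  · rw [hφ p (Nat.lt_succ_self _), weightedNorm_eq_sum_range p (Nat.lt_succ_self _)]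
    refine norm_sum_le_of_le _ fun j hj => ?_
    rw [norm_mul]
    gcongr
    exact hbound j

theorem exists_linearMap_shift_eq (P : ℕ → ℂ[X]) (hd : ∀ k, (P k).natDegree ≤ 4 ^ k)
    (hP : ∀ k, weightedNorm (P k) ≤ 2 ^ (4 * 4 ^ k)) :
    ∃ φ : ℂ[X] →ₗ[ℂ] ℂ, φ 1 = 1 ∧
      (∀ k, ∀ i < 2 * 4 ^ k, φ (X ^ (4 * 4 ^ k + i)) = φ (X ^ i * P k)) ∧
      (∀ k, ∀ i < 2 * 4 ^ k, φ (X ^ (8 * 4 ^ k + i)) = φ (X ^ i * P k ^ 2)) ∧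
      ∀ p, ‖φ p‖ ≤ weightedNorm p := by
  let K (n : ℕ) : ℕ := Nat.log 4 n - 1
  let A (n : ℕ) : ℂ[X] :=
    if 4 * 4 ^ K n ≤ n ∧ n < 6 * 4 ^ K n then X ^ (n - 4 * 4 ^ K n) * P (K n)
    else if 8 * 4 ^ K n ≤ n ∧ n < 10 * 4 ^ K n then X ^ (n - 8 * 4 ^ K n) * P (K n) ^ 2 else 0
  have hK (k n : ℕ) (h₁ : 4 * 4 ^ k ≤ n) (h₂ : n < 16 * 4 ^ k) : K n = k := by
    have : Nat.log 4 n = k + 1 := by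
      rw [Nat.log_eq_iff (by simp)]
      refine ⟨by rw [pow_succ]; omega, by rw [pow_succ, pow_succ]; omega⟩
    simp only [K, this, Nat.add_sub_cancel]
  have hXn (i : ℕ) (p : ℂ[X]) : (X ^ i * p).natDegree ≤ i + p.natDegree :=
    natDegree_mul_le.trans (by simp)
  have hXw (i : ℕ) (p : ℂ[X]) : weightedNorm (X ^ i * p) ≤ 2 ^ i * weightedNorm p := by
    simpa [weightedNorm_X_pow] using weightedNorm_mul_le (X ^ i) p
  obtain ⟨φ, h1, hφ, hb⟩ := exists_linearMap_X_pow_eq A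
    (fun n hn => by
      have h0 : 0 < 4 ^ K n := by positivity
      have hPd := hd (K n)
      simp only [A]
      split_ifs with h h'
      · have := hXn (n - 4 * 4 ^ K n) (P (K n))
        omega
      · have := hXn (n - 8 * 4 ^ K n) (P (K n) ^ 2)
        have h2 : (P (K n) ^ 2).natDegree ≤ 2 * (P (K n)).natDegree := natDegree_pow_le
        omega
      · simpa using Nat.pos_of_ne_zero hn)
    (fun n hn => by
      have hPw := hP (K n)
      simp only [A]
      split_ifs with h h'
      · refine (hXw _ _).trans ?_
        calc _ ≤ (2 : ℝ) ^ (n - 4 * 4 ^ K n) * 2 ^ (4 * 4 ^ K n) := by gcongr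
          _ = 2 ^ n := by rw [← pow_add, Nat.sub_add_cancel h.1]
      · refine (hXw _ _).trans ?_
        rw [pow_two (P (K n))]
        have hnn := weightedNorm_nonneg (P (K n))
        calc _ ≤ (2 : ℝ) ^ (n - 8 * 4 ^ K n) * (2 ^ (4 * 4 ^ K n) * 2 ^ (4 * 4 ^ K n)) := by
              gcongr
              exact (weightedNorm_mul_le _ _).trans (by gcongr)
          _ = 2 ^ n := by
              rw [← pow_add, ← pow_add]
              congr 1
              omega
      · rw [weightedNorm_zero]
        positivity)
  refine ⟨φ, h1, fun k i hi => ?_, fun k i hi => ?_, hb⟩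
  · have h0 : 0 < 4 ^ k := by positivity
    rw [hφ _ (by omega)]
    simp only [A, hK k (4 * 4 ^ k + i) (by omega) (by omega)]
    rw [if_pos (by omega), Nat.add_sub_cancel_left]
  · have h0 : 0 < 4 ^ k := by positivity
    rw [hφ _ (by omega)]
    simp only [A, hK k (8 * 4 ^ k + i) (by omega) (by omega)]
    rw [if_neg (by omega), if_pos (by omega), Nat.add_sub_cancel_left]

/-- The polynomials made small in the norm under construction: `1` and
`2 ^ k * (X ^ (4 * 4 ^ k) - P k)`. -/
noncomputable def smallPoly (P : ℕ → ℂ[X]) : Option ℕ → ℂ[X]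
  | none => 1
  | some k => C (2 ^ k) * (X ^ (4 * 4 ^ k) - P k)

theorem exists_linearMap_norm_mul_smallPoly_le (P : ℕ → ℂ[X])
    (hd : ∀ k, (P k).natDegree ≤ 4 ^ k) (hP : ∀ k, weightedNorm (P k) ≤ 2 ^ (4 * 4 ^ k)) :
    ∃ φ : ℂ[X] →ₗ[ℂ] ℂ, φ 1 = 1 ∧
      ∀ i a b, ‖φ (X ^ i * (smallPoly P a * smallPoly P b))‖ ≤ 4 * 2048 ^ i := by
  obtain ⟨φ, h1, hφ, hφ2, hb⟩ := exists_linearMap_shift_eq P hd hP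
  refine ⟨φ, h1, ?_⟩
  have hlin (k : ℕ) (p : ℂ[X]) (hp : p.natDegree < 2 * 4 ^ k) :
      φ (p * (X ^ (4 * 4 ^ k) - P k)) = 0 := by
    conv_lhs => rw [p.as_sum_range_C_mul_X_pow, Finset.sum_mul, map_sum]
    refine Finset.sum_eq_zero fun i hi => ?_
    rw [Finset.mem_range] at hi
    rw [mul_assoc, ← smul_eq_C_mul, map_smul, mul_sub, map_sub, ← pow_add, add_comm i,
      hφ k i (by omega), sub_self, smul_zero]
  have hsq (k i : ℕ) (hi : i < 4 ^ k) :
      φ (X ^ i * ((X ^ (4 * 4 ^ k) - P k) * (X ^ (4 * 4 ^ k) - P k))) = 0 := by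
    have hdeg : (X ^ i * P k).natDegree < 2 * 4 ^ k :=
      natDegree_mul_le.trans_lt (by have := hd k; simp; omega)
    have h := hlin k _ hdeg
    have e : X ^ i * ((X ^ (4 * 4 ^ k) - P k) * (X ^ (4 * 4 ^ k) - P k)) =
        X ^ (8 * 4 ^ k + i) - X ^ i * P k ^ 2 -
          (2 : ℂ) • (X ^ i * P k * (X ^ (4 * 4 ^ k) - P k)) := by
      rw [smul_eq_C_mul, show (8 * 4 ^ k + i) = 4 * 4 ^ k + 4 * 4 ^ k + i by ring, pow_add,
        pow_add, show (C (2 : ℂ) : ℂ[X]) = 2 from rfl]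
      ring
    rw [e, map_sub, map_sub, map_smul, h, hφ2 k i (by omega)]
    simp
  have hzero (k i : ℕ) (hi : i < 4 ^ k) (b : Option ℕ) (hbk : ∀ l ∈ b, l ≤ k) :
      φ (X ^ i * (smallPoly P (some k) * smallPoly P b)) = 0 := by
    match b with
    | none =>
      rw [smallPoly, smallPoly, mul_one, mul_left_comm, ← smul_eq_C_mul, map_smul,
        hlin k _ (by simp; omega), smul_zero]
    | some l =>
      rcases (hbk l rfl).eq_or_lt with rfl | hl
      · rw [smallPoly, show X ^ i * (C (2 ^ l) * (X ^ (4 * 4 ^ l) - P l) *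
          (C (2 ^ l) * (X ^ (4 * 4 ^ l) - P l))) = C (2 ^ l) * (C (2 ^ l) *
          (X ^ i * ((X ^ (4 * 4 ^ l) - P l) * (X ^ (4 * 4 ^ l) - P l)))) by ring,
          ← smul_eq_C_mul, ← smul_eq_C_mul, map_smul, map_smul, hsq l i hi]
        simp
      · have hdeg : (X ^ i * (X ^ (4 * 4 ^ l) - P l)).natDegree < 2 * 4 ^ k := by
          have hle : 4 * 4 ^ l ≤ 4 ^ k := by
            rw [← pow_succ']; exact Nat.pow_le_pow_right (by simp) hl
          have h2 : (X ^ (4 * 4 ^ l) - P l).natDegree ≤ 4 * 4 ^ l :=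
            (natDegree_sub_le _ _).trans (by have := hd l; simp; omega)
          refine natDegree_mul_le.trans_lt ?_
          rw [natDegree_X_pow]
          omega
        rw [smallPoly, smallPoly, show X ^ i * (C (2 ^ k) * (X ^ (4 * 4 ^ k) - P k) *
          (C (2 ^ l) * (X ^ (4 * 4 ^ l) - P l))) = C (2 ^ k) * (C (2 ^ l) *
          (X ^ i * (X ^ (4 * 4 ^ l) - P l) * (X ^ (4 * 4 ^ k) - P k))) by ring,
          ← smul_eq_C_mul, ← smul_eq_C_mul, map_smul, map_smul, hlin k _ hdeg]
        simp
  have hw (k : ℕ) : weightedNorm (smallPoly P (some k)) ≤ 2 * 2 ^ (5 * 4 ^ k) := by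
    have h1 : weightedNorm (X ^ (4 * 4 ^ k) - P k) ≤ 2 ^ (4 * 4 ^ k) + 2 ^ (4 * 4 ^ k) := by
      rw [sub_eq_add_neg]
      refine (weightedNorm_add_le _ _).trans ?_
      rw [weightedNorm_neg, weightedNorm_X_pow]
      gcongr
      exact hP k
    have h2 : (2 : ℝ) ^ k ≤ 2 ^ (4 ^ k) :=
      pow_le_pow_right₀ (by norm_num) (Nat.lt_pow_self (by simp)).le
    have h3 := weightedNorm_C_mul_X_pow_mul_le (2 ^ k) 0 (X ^ (4 * 4 ^ k) - P k)
    rw [pow_zero, mul_one, pow_zero, mul_one, norm_pow, Complex.norm_two] at h3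
    calc _ ≤ _ := h3
      _ ≤ 2 ^ (4 ^ k) * (2 ^ (4 * 4 ^ k) + 2 ^ (4 * 4 ^ k)) :=
        mul_le_mul h2 h1 (weightedNorm_nonneg _) (by positivity)
      _ = 2 * 2 ^ (5 * 4 ^ k) := by
        rw [show 5 * 4 ^ k = 4 ^ k + 4 * 4 ^ k by ring, pow_add]; ring
  have hone : weightedNorm (smallPoly P none) = 1 := by
    simpa [smallPoly] using weightedNorm_X_pow 0
  have hmain (k i : ℕ) (b : Option ℕ) (hbk : ∀ l ∈ b, l ≤ k) :
      ‖φ (X ^ i * (smallPoly P (some k) * smallPoly P b))‖ ≤ 4 * 2048 ^ i := by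
    rcases lt_or_ge i (4 ^ k) with hi | hi
    · rw [hzero k i hi b hbk, norm_zero]
      positivity
    · have hwb : weightedNorm (smallPoly P b) ≤ 2 * 2 ^ (5 * 4 ^ k) := by
        match b with
        | none =>
          rw [hone]
          have := one_le_pow₀ (M₀ := ℝ) (a := 2) (by norm_num) (n := 5 * 4 ^ k)
          linarith
        | some l =>
          refine (hw l).trans ?_
          gcongr
          · norm_num
          · norm_num
          · exact hbk l rfl
      calc _ ≤ _ := hb _
        _ ≤ 2 ^ i * ((2 * 2 ^ (5 * 4 ^ k)) * (2 * 2 ^ (5 * 4 ^ k))) := by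
          refine (weightedNorm_mul_le _ _).trans ?_
          rw [weightedNorm_X_pow]
          gcongr
          exact (weightedNorm_mul_le _ _).trans
            (mul_le_mul (hw k) hwb (weightedNorm_nonneg _) (by positivity))
        _ = 4 * (2 ^ i * 2 ^ (10 * 4 ^ k)) := by
          rw [show 10 * 4 ^ k = 5 * 4 ^ k + 5 * 4 ^ k by ring, pow_add 2 (5 * 4 ^ k)]; ring
        _ ≤ 4 * (2 ^ i * 2 ^ (10 * i)) := by
          gcongr
          norm_num
        _ = 4 * 2048 ^ i := by
          rw [← pow_add, show i + 10 * i = 11 * i by ring, pow_mul]; norm_num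
  intro i a b
  match a, b with
  | none, none =>
    refine (hb _).trans ((weightedNorm_mul_le _ _).trans ?_)
    rw [weightedNorm_X_pow]
    have h2 : weightedNorm (smallPoly P none * smallPoly P none) ≤ 1 := by
      simpa [hone] using weightedNorm_mul_le (smallPoly P none) (smallPoly P none)
    calc (2 : ℝ) ^ i * _ ≤ 2048 ^ i * 4 :=
          mul_le_mul (by gcongr; norm_num) (by linarith) (weightedNorm_nonneg _) (by positivity)
      _ = _ := mul_comm _ _
  | some k, none => exact hmain k i none (by simp)
  | none, some k =>
    rw [mul_comm (smallPoly P none)]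
    exact hmain k i none (by simp)
  | some k, some l =>
    rcases le_total l k with h | h
    · exact hmain k i (some l) (by simpa using h)
    · rw [mul_comm (smallPoly P (some k))]
      exact hmain l i (some k) (by simpa using h)

theorem not_denseRange_pow_mul (μ c : ℂ) : ¬DenseRange fun n : ℕ => μ ^ n * c := by
  intro h
  by_cases hb : ‖μ‖ ≤ 1 ∨ c = 0
  · have h1 : Set.range (fun n : ℕ => μ ^ n * c) ⊆ Metric.closedBall 0 ‖c‖ := by
      rintro _ ⟨n, rfl⟩
      rcases hb with hb | rfl
      · simpa using mul_le_of_le_one_left (norm_nonneg c) (pow_le_one₀ (norm_nonneg μ) hb)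
      · simp
    have h2 := Metric.isClosed_closedBall.closure_subset_iff.2 h1
      (h.closure_eq ▸ Set.mem_univ ((‖c‖ + 1 : ℝ) : ℂ))
    rw [mem_closedBall_zero_iff, Complex.norm_real, Real.norm_eq_abs,
      abs_of_nonneg (by positivity)] at h2
    linarith
  · push Not at hb
    have h1 : Set.range (fun n : ℕ => μ ^ n * c) ⊆ {z | ‖c‖ ≤ ‖z‖} := by
      rintro _ ⟨n, rfl⟩
      simpa using le_mul_of_one_le_left (norm_nonneg c) (one_le_pow₀ hb.1.le)
    have h2 := (isClosed_le continuous_const continuous_norm).closure_subset_iff.2 h1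
      (h.closure_eq ▸ Set.mem_univ (0 : ℂ))
    simp [hb.2] at h2

theorem Hypercyclic.not_finiteDimensional {X : Type*} [NormedAddCommGroup X] [NormedSpace ℂ X]
    [Nontrivial X] {T : X →L[ℂ] X} (hT : Hypercyclic T) : ¬FiniteDimensional ℂ X := by
  intro hfin
  obtain ⟨x, hx⟩ := hT
  obtain ⟨μ, hμ⟩ := Module.End.exists_eigenvalue (K := ℂ) (V := Module.Dual ℂ X)
    (Module.Dual.transpose (R := ℂ) (T : X →ₗ[ℂ] X))
  obtain ⟨ψ, hψ⟩ := hμ.exists_hasEigenvector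
  have hψT (y : X) : ψ (T y) = μ * ψ y := by
    exact LinearMap.congr_fun hψ.apply_eq_smul y
  have hpow (n : ℕ) : ψ ((T ^ n) x) = μ ^ n * ψ x := by
    induction n with
    | zero => simp
    | succ n ih => rw [pow_succ', mul_apply_eq_comp, hψT, ih]; ring
  have hd : DenseRange fun n : ℕ => (T ^ n) x := hx
  have h := ((LinearMap.surjective hψ.2).denseRange).comp hd
    (LinearMap.continuous_of_finiteDimensional ψ)
  exact not_denseRange_pow_mul μ (ψ x) (by simpa only [Function.comp_def, hpow] using h)

/-- An operator which is symmetric for a nondegenerate symmetric bilinear form cannot have a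
hypercyclic direct sum with itself. The form is given as a map `J` on a quotient `X` of `Y`. -/
theorem not_hypercyclic_prodMap {X Y : Type*} [NormedAddCommGroup X] [NormedSpace ℂ X]
    [NormedAddCommGroup Y] [NormedSpace ℂ Y] [Nontrivial X] {T : X →L[ℂ] X} {S : Y →L[ℂ] Y}
    {π : Y →L[ℂ] X} (hπ : Function.Surjective π) (hST : ∀ y, π (S y) = T (π y))
    {J : X →L[ℂ] Y →L[ℂ] ℂ} (hJ : Function.Injective J)
    (hsymm : ∀ y z, J (π y) z = J (π z) y) (hS : ∀ y z, J (π (S y)) z = J (π y) (S z)) :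
    ¬Hypercyclic (T.prodMap T) := by
  rintro ⟨⟨u, v⟩, hx⟩
  obtain ⟨y, rfl⟩ := hπ u
  obtain ⟨z, rfl⟩ := hπ v
  have hTn (n : ℕ) (w : Y) : (T ^ n) (π w) = π ((S ^ n) w) := by
    induction n with
    | zero => simp
    | succ n ih =>
      rw [pow_succ', pow_succ', mul_apply_eq_comp, mul_apply_eq_comp,
        hST, ih]
  have hSn (n : ℕ) (y z : Y) : J (π ((S ^ n) y)) z = J (π y) ((S ^ n) z) := by
    induction n generalizing z with
    | zero => simp
    | succ n ih =>
      rw [pow_succ', mul_apply_eq_comp, hS, ih, ← mul_apply_eq_comp,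
        ← pow_succ, pow_succ']
  have hprod (n : ℕ) :
      ((T.prodMap T) ^ n) (π y, π z) = ((T ^ n) (π y), (T ^ n) (π z)) := by
    induction n with
    | zero => simp
    | succ n ih => simp [pow_succ', ih]
  have hzero (p : X × X) : J p.2 y - J p.1 z = 0 := by
    have hc : IsClosed {p : X × X | J p.2 y - J p.1 z = 0} :=
      isClosed_eq (by fun_prop) continuous_const
    refine hc.closure_subset_iff.2 ?_ (hx.closure_eq ▸ Set.mem_univ p)
    rintro _ ⟨n, rfl⟩
    simp only [hprod, Set.mem_ofPred_eq, hTn]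
    rw [hSn n y z, hsymm ((S ^ n) z) y, sub_self]
  have hy : π y = 0 := hJ (by
    ext w
    rw [map_zero, hsymm y w]
    simpa using hzero (0, π w))
  obtain ⟨q, hq⟩ := exists_ne (0 : X)
  have h0 : IsClosed {p : X × X | p.1 = 0} := isClosed_eq continuous_fst continuous_const
  refine hq (h0.closure_subset_iff.2 ?_ (hx.closure_eq ▸ Set.mem_univ (q, 0)))
  rintro _ ⟨n, rfl⟩
  simp only [hprod, Set.mem_ofPred_eq]
  simp [hy]

theorem lp_one_exists_continuousLinearMap {ι E : Type*} [DecidableEq ι] [NormedAddCommGroup E]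
    [NormedSpace ℂ E] [CompleteSpace E] (v : ι → E) {C : ℝ} (hC : 0 ≤ C)
    (hv : ∀ i, ‖v i‖ ≤ C) :
    ∃ L : lp (fun _ : ι => ℂ) 1 →L[ℂ] E, (∀ i, L (lp.single 1 i 1) = v i) ∧ ‖L‖ ≤ C := by
  have hle (y : lp (fun _ : ι => ℂ) 1) (i : ι) : ‖y i • v i‖ ≤ ‖y i‖ * C := by
    rw [norm_smul]
    exact mul_le_mul_of_nonneg_left (hv i) (norm_nonneg _)
  have hnorm (y : lp (fun _ : ι => ℂ) 1) : HasSum (fun i => ‖y i‖) ‖y‖ := by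
    simpa using lp.hasSum_norm (by simp) y
  have hs (y : lp (fun _ : ι => ℂ) 1) : Summable fun i => y i • v i :=
    .of_norm_bounded ((hnorm y).summable.mul_right C) (hle y)
  let L : lp (fun _ : ι => ℂ) 1 →ₗ[ℂ] E :=
    { toFun := fun y => ∑' i, y i • v i
      map_add' := fun y z => by
        rw [← (hs y).tsum_add (hs z)]
        simp [add_smul]
      map_smul' := fun c y => by
        rw [RingHom.id_apply, ← (hs y).tsum_const_smul c]
        simp [mul_smul] }
  have hL (y : lp (fun _ : ι => ℂ) 1) : ‖L y‖ ≤ C * ‖y‖ := by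
    rw [mul_comm]
    exact tsum_of_norm_bounded ((hnorm y).mul_right C) (hle y)
  refine ⟨L.mkContinuous C hL, fun i => ?_, L.mkContinuous_norm_le hC hL⟩
  change ∑' j, (lp.single 1 i (1 : ℂ) : lp (fun _ : ι => ℂ) 1) j • v j = v i
  rw [tsum_eq_single i fun j hj => by rw [lp.single_apply_ne 1 i _ hj, zero_smul],
    lp.single_apply_self, one_smul]

theorem dense_span_range_single (ι : Type*) [DecidableEq ι] :
    Dense (Submodule.span ℂ
      (Set.range fun i => (lp.single 1 i 1 : lp (fun _ : ι => ℂ) 1)) :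
      Set (lp (fun _ : ι => ℂ) 1)) := by
  intro y
  refine mem_closure_of_tendsto (lp.hasSum_single (by simp) y) (Eventually.of_forall fun s => ?_)
  refine Submodule.sum_mem _ fun i _ => ?_
  have h : lp.single 1 i (y i) = y i • (lp.single 1 i 1 : lp (fun _ : ι => ℂ) 1) := by
    rw [← lp.single_smul, smul_eq_mul, mul_one]
  rw [h]
  exact Submodule.smul_mem _ _ (Submodule.subset_span ⟨i, rfl⟩)

theorem separableSpace_lp_one (ι : Type*) [Countable ι] :
    TopologicalSpace.SeparableSpace (lp (fun _ : ι => ℂ) 1) := by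
  classical
  have h := (Set.countable_range fun i =>
    (lp.single 1 i 1 : lp (fun _ : ι => ℂ) 1)).isSeparable.span (R := ℂ) |>.closure
  rwa [(dense_span_range_single ι).closure_eq, TopologicalSpace.isSeparable_univ_iff] at h

/-- It suffices to find an operator which is symmetric for a symmetric bounded bilinear form and
which has a dense orbit modulo the radical of the form. -/
theorem exists_hypercyclic_of_bilinear_form {Y : Type} [NormedAddCommGroup Y] [NormedSpace ℂ Y]
    [CompleteSpace Y] [TopologicalSpace.SeparableSpace Y] (S : Y →L[ℂ] Y) (β : Y →L[ℂ] Y →L[ℂ] ℂ)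
    (x : Y) (hβ : β ≠ 0) (hsymm : ∀ y z, β y z = β z y) (hS : ∀ y z, β (S y) z = β y (S z))
    (hx : ∀ y, ∀ ε > 0, ∃ n w, β w = 0 ∧ ‖y - (S ^ n) x - w‖ < ε) :
    ∃ (X : Type) (inst1 : NormedAddCommGroup X),
      letI := inst1
      ∃ (inst2 : NormedSpace ℂ X),
        letI := inst2
        CompleteSpace X ∧ TopologicalSpace.SeparableSpace X ∧ ¬FiniteDimensional ℂ X ∧
          ∃ T : X →L[ℂ] X, Hypercyclic T ∧ ¬Hypercyclic (T.prodMap T) := by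
  let K : Submodule ℂ Y := β.ker
  have hK (y : Y) : y ∈ K ↔ β y = 0 := LinearMap.mem_ker
  have : IsClosed (K : Set Y) := β.isClosed_ker
  let π : Y →L[ℂ] Y ⧸ K := K.mkQL
  have hπ : Function.Surjective π := K.mkQ_surjective
  have hπ0 (y : Y) : π y = 0 ↔ β y = 0 := (Submodule.Quotient.mk_eq_zero K).trans (hK y)
  have hSK : K ≤ (π.comp S).ker := fun y hy => by
    change π (S y) = 0
    rw [hπ0]
    ext z
    rw [hS, (hK y).1 hy]
    simp
  let T : Y ⧸ K →L[ℂ] Y ⧸ K := K.liftQL (π.comp S) hSK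
  let J : Y ⧸ K →L[ℂ] Y →L[ℂ] ℂ := K.liftQL β le_rfl
  have hST (y : Y) : π (S y) = T (π y) := rfl
  have hJπ (y : Y) : J (π y) = β y := rfl
  have hJ : Function.Injective J := by
    rw [injective_iff_map_eq_zero]
    intro q hq
    obtain ⟨y, rfl⟩ := hπ q
    exact (hπ0 y).2 hq
  have hnt : Nontrivial (Y ⧸ K) := by
    obtain ⟨y, hy⟩ := DFunLike.ne_iff.1 hβ
    exact ⟨π y, 0, fun h => hy ((hπ0 y).1 h)⟩
  have hTn (n : ℕ) (y : Y) : (T ^ n) (π y) = π ((S ^ n) y) := by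
    induction n with
    | zero => simp
    | succ n ih => rw [pow_succ', pow_succ', mul_apply_eq_comp, mul_apply_eq_comp, hST, ih]
  have hhyp : Hypercyclic T := by
    refine ⟨π x, Metric.dense_iff.2 fun q ε hε => ?_⟩
    obtain ⟨y, rfl⟩ := hπ q
    obtain ⟨n, w, hw, hn⟩ := hx y ε hε
    refine ⟨_, ?_, n, rfl⟩
    rw [Metric.mem_ball', dist_eq_norm]
    dsimp only
    rw [hTn, ← map_sub, ← sub_zero (π _), ← (hπ0 w).2 hw, ← map_sub]
    exact (Submodule.Quotient.norm_mk_le K _).trans_lt hn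
  exact ⟨Y ⧸ K, inferInstance, inferInstance, inferInstance,
    hπ.denseRange.separableSpace π.continuous, hhyp.not_finiteDimensional, T, hhyp,
    not_hypercyclic_prodMap hπ hST hJ (fun y z => by rw [hJπ, hJπ, hsymm])
      fun y z => by rw [hJπ, hJπ, hS]⟩

theorem exists_polynomial_seq_frequently_eq (Q : ℕ → ℂ[X]) :
    ∃ P : ℕ → ℂ[X], (∀ k, (P k).natDegree ≤ 4 ^ k) ∧
      (∀ k, weightedNorm (P k) ≤ 2 ^ (4 * 4 ^ k)) ∧ ∀ m N, ∃ k ≥ N, P k = Q m := by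
  classical
  refine ⟨fun k => if (Q k.unpair.1).natDegree ≤ 4 ^ k ∧
    weightedNorm (Q k.unpair.1) ≤ 2 ^ (4 * 4 ^ k) then Q k.unpair.1 else 0,
    fun k => ?_, fun k => ?_, fun m N => ?_⟩
  · dsimp only
    split_ifs with h
    · exact h.1
    · simp
  · dsimp only
    split_ifs with h
    · exact h.2
    · rw [weightedNorm_zero]
      positivity
  · obtain ⟨M, hM⟩ := pow_unbounded_of_one_lt (weightedNorm (Q m)) (one_lt_two : (1 : ℝ) < 2)
    set t := N + M + (Q m).natDegree
    set k := Nat.pair m t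
    have hk : t ≤ k := Nat.right_le_pair m t
    have h4 : k < 4 ^ k := Nat.lt_pow_self (by simp)
    refine ⟨k, by omega, ?_⟩
    have hkm : k.unpair.1 = m := by simp [k]
    simp only [hkm]
    rw [if_pos]
    exact ⟨by omega, hM.le.trans (pow_le_pow_right₀ one_le_two (by omega))⟩

/-- De La Rosa–Read: there are a separable infinite-dimensional Banach space `X` and a
hypercyclic bounded operator `T` on `X` such that `T ⊕ T` is not hypercyclic on `X × X`. -/
theorem exists_hypercyclic_with_prodMap_not_hypercyclic :
    ∃ (X : Type) (inst1 : NormedAddCommGroup X),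
      letI := inst1
      ∃ (inst2 : NormedSpace ℂ X),
        letI := inst2
        CompleteSpace X ∧ TopologicalSpace.SeparableSpace X ∧ ¬FiniteDimensional ℂ X ∧
          ∃ T : X →L[ℂ] X, Hypercyclic T ∧ ¬Hypercyclic (T.prodMap T) := by
  let Y := lp (fun _ : ℕ × Option ℕ => ℂ) 1
  let e (s : ℕ × Option ℕ) : Y := lp.single 1 s 1
  have he (s : ℕ × Option ℕ) : ‖e s‖ = 1 := lp.norm_single one_pos s 1 |>.trans norm_one
  have hdense : Dense (Submodule.span ℂ (Set.range e) : Set Y) := dense_span_range_single _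
  have : TopologicalSpace.SeparableSpace Y := separableSpace_lp_one _
  obtain ⟨S, hS⟩ : ∃ S : Y →L[ℂ] Y, ∀ s, S (e s) = (2048 : ℂ) • e (s.1 + 1, s.2) :=
    (lp_one_exists_continuousLinearMap _ (C := 2048) (by norm_num)
      fun s => by rw [norm_smul, he]; simp).imp fun _ h => h.1
  let ι : ℂ[X] →ₗ[ℂ] Y :=
    (ContinuousLinearMap.apply ℂ Y (e (0, none))).toLinearMap ∘ₗ (aeval S).toLinearMap
  have hι (p : ℂ[X]) : ι p = aeval S p (e (0, none)) := rfl
  have hιX (n : ℕ) : ι (X ^ n) = (2048 : ℂ) ^ n • e (n, none) := by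
    induction n with
    | zero => simp [hι]
    | succ n ih =>
      rw [hι, map_pow, aeval_X] at ih ⊢
      rw [pow_succ', mul_apply_eq_comp, ih, map_smul, hS, smul_smul, pow_succ]
  obtain ⟨Q, hQ⟩ : ∃ Q : ℕ → ℂ[X], ∀ p, ∀ δ > 0, ∃ m, ‖ι p - ι (Q m)‖ < δ := by
    obtain ⟨u, hu⟩ := TopologicalSpace.exists_dense_seq (Set.range ι)
    choose Q hQ using fun m => (u m).2
    refine ⟨Q, fun p δ hδ => ?_⟩
    obtain ⟨m, hm⟩ := hu.exists_dist_lt ⟨ι p, p, rfl⟩ hδ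
    refine ⟨m, ?_⟩
    rwa [hQ m, ← dist_eq_norm]
  obtain ⟨P, hPd, hPw, hPQ⟩ := exists_polynomial_seq_frequently_eq Q
  obtain ⟨φ, hφ1, hφ⟩ := exists_linearMap_norm_mul_smallPoly_le P hPd hPw
  let v (s : ℕ × Option ℕ) : ℂ[X] := C ((2048 : ℂ)⁻¹ ^ s.1) * (X ^ s.1 * smallPoly P s.2)
  have hv (s t : ℕ × Option ℕ) : ‖φ (v s * v t)‖ ≤ 4 := by
    have e1 : v s * v t = ((2048 : ℂ)⁻¹ ^ (s.1 + t.1)) •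
        (X ^ (s.1 + t.1) * (smallPoly P s.2 * smallPoly P t.2)) := by
      simp only [v, smul_eq_C_mul, pow_add, C_mul]
      ring
    rw [e1, map_smul, norm_smul, norm_pow, norm_inv, inv_pow, inv_mul_le_iff₀ (by simp)]
    simpa [mul_comm] using hφ (s.1 + t.1) s.2 t.2
  have hvS (s : ℕ × Option ℕ) : (2048 : ℂ) • v (s.1 + 1, s.2) = X * v s := by
    simp only [v, smul_eq_C_mul]
    rw [← mul_assoc, ← C_mul, pow_succ', mul_inv_cancel_left₀ (by norm_num), pow_succ']
    ring
  choose β₀ hβ₀ hβ₀n using fun s =>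
    lp_one_exists_continuousLinearMap (fun t => φ (v s * v t)) zero_le_four (hv s)
  obtain ⟨β, hβ, -⟩ := lp_one_exists_continuousLinearMap β₀ zero_le_four hβ₀n
  have hβe (s t : ℕ × Option ℕ) : β (e s) (e t) = φ (v s * v t) := by
    simp only [e, hβ, hβ₀]
  have hext {f g : Y →L[ℂ] ℂ} (h : ∀ s, f (e s) = g (e s)) : f = g :=
    ContinuousLinearMap.ext_on hdense (by rintro _ ⟨s, rfl⟩; exact h s)
  have hext₂ {f g : Y →L[ℂ] Y →L[ℂ] ℂ} (h : ∀ s t, f (e s) (e t) = g (e s) (e t)) : f = g :=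
    ContinuousLinearMap.ext_on hdense (by rintro _ ⟨s, rfl⟩; exact hext (h s))
  have hsymm : β = β.flip := hext₂ fun s t => by
    rw [ContinuousLinearMap.flip_apply, hβe, hβe, mul_comm]
  have hβS : β.comp S = (β.flip.comp S).flip := hext₂ fun s t => by
    simp only [ContinuousLinearMap.flip_apply, ContinuousLinearMap.comp_apply, hS, map_smul,
      smul_apply, hβe]
    rw [← map_smul, ← map_smul, ← smul_mul_assoc _ (v (s.1 + 1, s.2)),
      ← mul_smul_comm _ _ (v (t.1 + 1, t.2)), hvS, hvS]
    congr 1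
    ring
  have hv_none (n : ℕ) : (2048 : ℂ) ^ n • v (n, none) = X ^ n := by
    simp only [v, smallPoly, smul_eq_C_mul, mul_one]
    rw [← mul_assoc, ← C_mul, ← mul_pow, mul_inv_cancel₀ (by norm_num), one_pow, C_1, one_mul]
  have hv_some (k : ℕ) : v (0, some k) = (2 : ℂ) ^ k • (X ^ (4 * 4 ^ k) - P k) := by
    simp [v, smallPoly, smul_eq_C_mul]
  have hβι (p : ℂ[X]) (t : ℕ × Option ℕ) : β (ι p) (e t) = φ (p * v t) := by
    induction p using Polynomial.induction_on' with
    | add p q hp hq => rw [map_add, map_add, add_apply, hp, hq, add_mul, map_add]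
    | monomial n a =>
      rw [← C_mul_X_pow_eq_monomial, ← smul_eq_C_mul, map_smul, hιX, map_smul, map_smul,
        smul_apply, smul_apply, hβe, smul_mul_assoc,
        map_smul, ← map_smul φ, ← smul_mul_assoc, hv_none]
  have hker (s : ℕ × Option ℕ) : β (e s - ι (v s)) = 0 := hext fun t => by
    rw [map_sub, sub_apply, hβe, hβι, sub_self, zero_apply]
  have hspan (y : Y) (hy : y ∈ Submodule.span ℂ (Set.range e)) : ∃ p, β (y - ι p) = 0 := by
    induction hy using Submodule.span_induction with
    | mem y hy =>
      obtain ⟨s, rfl⟩ := hy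
      exact ⟨v s, hker s⟩
    | zero => exact ⟨0, by simp⟩
    | add y z _ _ hy hz =>
      obtain ⟨p, hp⟩ := hy
      obtain ⟨q, hq⟩ := hz
      exact ⟨p + q, by rw [map_add, add_sub_add_comm, map_add, hp, hq, add_zero]⟩
    | smul a y _ hy =>
      obtain ⟨p, hp⟩ := hy
      exact ⟨a • p, by rw [map_smul, ← smul_sub, map_smul, hp, smul_zero]⟩
  refine exists_hypercyclic_of_bilinear_form S β (e (0, none)) (fun h => ?_)
    (fun y z => DFunLike.congr_fun (DFunLike.congr_fun hsymm y) z)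
    (fun y z => DFunLike.congr_fun (DFunLike.congr_fun hβS y) z) fun y ε hε => ?_
  · have h1 := hβe (0, none) (0, none)
    simp [h, v, smallPoly, hφ1] at h1
  · obtain ⟨y', hy', hyy'⟩ := Metric.dense_iff.1 hdense y (ε / 3) (by positivity)
    obtain ⟨p, hp⟩ := hspan y' hyy'
    obtain ⟨m, hm⟩ := hQ p (ε / 3) (by positivity)
    obtain ⟨N, hN⟩ := exists_pow_lt_of_lt_one (show 0 < ε / 3 by positivity)
      (show (1 / 2 : ℝ) < 1 by norm_num)
    obtain ⟨k, hk, hPk⟩ := hPQ m N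
    have hsmall : ‖((2 : ℂ) ^ k)⁻¹ • e (0, some k)‖ < ε / 3 := by
      rw [norm_smul, he, mul_one, norm_inv, norm_pow, Complex.norm_two, ← inv_pow, ← one_div]
      exact (pow_le_pow_of_le_one (by norm_num) (by norm_num) hk).trans_lt hN
    have hXk : ι (X ^ (4 * 4 ^ k)) = ι (Q m) + ((2 : ℂ) ^ k)⁻¹ • ι (v (0, some k)) := by
      rw [hv_some, map_smul, inv_smul_smul₀ (by simp), map_sub, hPk]
      abel
    refine ⟨4 * 4 ^ k, (y' - ι p) + ((2 : ℂ) ^ k)⁻¹ • (e (0, some k) - ι (v (0, some k))), ?_, ?_⟩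
    · exact β.ker.add_mem hp (β.ker.smul_mem _ (hker _))
    · have hSk : (S ^ (4 * 4 ^ k)) (e (0, none)) = ι (X ^ (4 * 4 ^ k)) := by
        rw [hι, map_pow, aeval_X]
      rw [mem_ball_iff_norm'] at hy'
      calc ‖_‖ = ‖(y - y') + (ι p - ι (Q m)) - ((2 : ℂ) ^ k)⁻¹ • e (0, some k)‖ := by
            rw [hSk, hXk, smul_sub]
            congr 1
            abel
        _ ≤ ‖y - y'‖ + ‖ι p - ι (Q m)‖ + ‖((2 : ℂ) ^ k)⁻¹ • e (0, some k)‖ :=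
            (norm_sub_le _ _).trans (by gcongr; exact norm_add_le _ _)
        _ < ε := by linarith
end

section
/- Let T be a weakly hypercyclic bounded linear operator on a complex Banach space X. Then (a) T^n is weakly hypercyclic for every integer n ≥ 1, and (b) λT is weakly hypercyclic for every λ ∈ ℂ with |λ| = 1. -/
open Filter Topology

/-- A bounded operator `T` on a Banach space is weakly hypercyclic if some vector has an
orbit which is dense in the weak topology. -/
def WeaklyHypercyclic {𝕜 X : Type*} [NontriviallyNormedField 𝕜]
    [NormedAddCommGroup X] [NormedSpace 𝕜 X] (T : X →L[𝕜] X) : Prop :=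
  ∃ x : X, Dense (Set.range fun n : ℕ => (show WeakSpace 𝕜 X from (T ^ n) x))

open Set Function

/-- A closed subgroup of the circle is separated from each point outside it by a power map. -/
theorem Circle.exists_zpow_ne_one_of_notMem {H : Subgroup Circle} (hH : IsClosed (H : Set Circle))
    {g : Circle} (hg : g ∉ H) : ∃ m : ℤ, (∀ z ∈ H, z ^ m = 1) ∧ g ^ m ≠ 1 := by
  have exp_zsmul (k : ℤ) (r : ℝ) : Circle.exp (k * r) = Circle.exp r ^ k := by
    simp
  let K : AddSubgroup ℝ :=
    { carrier := {r | Circle.exp r ∈ H}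
      zero_mem' := by simp
      add_mem' := fun {a b} ha hb => by
        simpa only [mem_ofPred_eq, Circle.exp_add] using H.mul_mem ha hb
      neg_mem' := fun {a} ha => by simpa using ha }
  have mem_K (r : ℝ) : r ∈ K ↔ Circle.exp r ∈ H := Iff.rfl
  obtain ⟨θ, rfl⟩ := Circle.exp_surjective g
  rcases K.dense_or_cyclic with hK | ⟨a, ha⟩
  · have hKc : IsClosed (K : Set ℝ) := hH.preimage Circle.exp.continuous
    have : θ ∈ (K : Set ℝ) := by rw [← hKc.closure_eq, hK.closure_eq]; trivial
    exact absurd this hg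
  · have mem_K' (r : ℝ) : r ∈ K ↔ ∃ k : ℤ, k * a = r := by
      rw [ha, AddSubgroup.mem_closure_singleton]; simp
    obtain ⟨m, hm⟩ := (mem_K' (2 * Real.pi)).1 (by simp [mem_K])
    have hm0 : (m : ℝ) ≠ 0 := by
      rintro h
      rw [h, zero_mul] at hm
      exact Real.two_pi_pos.ne hm
    refine ⟨m, fun z hz => ?_, fun h => hg ?_⟩
    · obtain ⟨r, rfl⟩ := Circle.exp_surjective z
      obtain ⟨k, rfl⟩ := (mem_K' r).1 hz
      rw [← exp_zsmul, mul_left_comm, hm, Circle.exp_int_mul_two_pi]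
    · rw [← exp_zsmul, Circle.exp_eq_one] at h
      obtain ⟨n, hn⟩ := h
      refine (mem_K' θ).2 ⟨n, mul_left_cancel₀ hm0 ?_⟩
      rw [hn, ← hm]; ring

theorem Circle.exists_continuous_exp_eq {A : Type*} [TopologicalSpace A] [ContractibleSpace A]
    {f : A → Circle} (hf : Continuous f) :
    ∃ φ : A → ℝ, Continuous φ ∧ ∀ a, Circle.exp (φ a) = f a := by
  obtain ⟨a₀, ⟨F⟩⟩ := id_nullhomotopic A
  obtain ⟨r, hr⟩ := Circle.exp_surjective (f a₀)
  let H : C(unitInterval × A, Circle) := (ContinuousMap.mk f hf).comp F.symm.toContinuousMap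
  have H₀ (a : A) : H (0, a) = Circle.exp (ContinuousMap.const A r a) := by
    simp [H, hr]
  refine ⟨fun a => Circle.isCoveringMap_exp.liftHomotopy H (.const A r) H₀ (1, a),
    by fun_prop, fun a => ?_⟩
  have := congrFun (Circle.isCoveringMap_exp.liftHomotopy_lifts H (.const A r) H₀) (1, a)
  rw [comp_apply] at this
  rw [this]
  simp [H]

/-- On a contractible space, a continuous circle-valued eigenfunction of a continuous map
having a recurrent point is invariant. -/
theorem Circle.eq_one_of_eigenfunction {A : Type*} [TopologicalSpace A] [ContractibleSpace A]
    {f : A → Circle} (hf : Continuous f) {S : A → A} (hS : Continuous S) {c : Circle}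
    (hfS : ∀ a, f (S a) = c * f a) {a : A}
    (ha : a ∈ closure (range fun k : ℕ => S^[k + 1] a)) : c = 1 := by
  obtain ⟨φ, hφ, hexp⟩ := Circle.exists_continuous_exp_eq hf
  have hconst (y : A) : φ (S y) - φ y = φ (S a) - φ a :=
    Circle.isCoveringMap_exp.const_of_comp (g := fun y => φ (S y) - φ y) (by fun_prop)
      (fun y z => by simp [Circle.exp_sub, hexp, hfS]) y a
  set θ := φ (S a) - φ a with hθ
  have hiter (k : ℕ) : φ (S^[k] a) = φ a + k * θ := by
    induction k with
    | zero => simp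
    | succ k ih =>
      have := hconst (S^[k] a)
      rw [← iterate_succ_apply' S] at this
      push_cast
      linarith
  have hc : Circle.exp θ = c := by simp [hθ, Circle.exp_sub, hexp, hfS]
  suffices θ = 0 by rw [← hc, this, Circle.exp_zero]
  by_contra h0
  obtain ⟨_, hk, k, rfl⟩ := mem_closure_iff.1 ha {y | |φ y - φ a| < |θ|}
    (isOpen_lt (by fun_prop) continuous_const) (by simpa using h0)
  rw [mem_ofPred_eq, hiter, add_sub_cancel_left, abs_mul, Nat.abs_cast] at hk
  have := abs_nonneg θ
  have : (1 : ℝ) ≤ (k + 1 : ℕ) := by simp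
  nlinarith

section SkewOrbit

variable {E G : Type*} [TopologicalSpace E] [TopologicalSpace G] [CommGroup G]

/-- The closure of the orbit of `(u, 1)` under `(y, h) ↦ (S y, g * h)`. -/
def skewOrbitClosure (S : E → E) (g : G) (u : E) : Set (E × G) :=
  closure (range fun n : ℕ => (S^[n] u, g ^ n))

variable {S : E → E} {g : G} {u v w : E} {μ ν : G}

theorem isClosed_skewOrbitClosure : IsClosed (skewOrbitClosure S g u) := isClosed_closure

theorem iterate_mem_skewOrbitClosure (n : ℕ) : (S^[n] u, g ^ n) ∈ skewOrbitClosure S g u :=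
  subset_closure ⟨n, rfl⟩

theorem exists_mem_skewOrbitClosure [CompactSpace G] (hu : Dense (range fun n : ℕ => S^[n] u))
    (v : E) : ∃ μ, (v, μ) ∈ skewOrbitClosure S g u := by
  have hcl : IsClosed (Prod.fst '' skewOrbitClosure S g u) :=
    isClosedMap_fst_of_compactSpace _ isClosed_skewOrbitClosure
  have hsub : (range fun n : ℕ => S^[n] u) ⊆ Prod.fst '' skewOrbitClosure S g u := by
    rintro _ ⟨n, rfl⟩
    exact ⟨_, iterate_mem_skewOrbitClosure n, rfl⟩
  obtain ⟨⟨_, μ⟩, hμ, rfl⟩ := closure_minimal hsub hcl (hu v)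
  exact ⟨μ, hμ⟩

variable [IsTopologicalGroup G]

theorem skewOrbitClosure_trans (hS : Continuous S) (hv : (v, μ) ∈ skewOrbitClosure S g u)
    (hw : (w, ν) ∈ skewOrbitClosure S g v) : (w, ν * μ) ∈ skewOrbitClosure S g u := by
  have step : MapsTo (fun p : E × G => (S p.1, g * p.2)) (skewOrbitClosure S g u)
      (skewOrbitClosure S g u) := by
    refine MapsTo.closure ?_ (by fun_prop)
    rintro _ ⟨n, rfl⟩
    exact ⟨n + 1, by simp only [iterate_succ_apply', pow_succ']⟩
  have iter (n : ℕ) : (S^[n] v, g ^ n * μ) ∈ skewOrbitClosure S g u := by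
    induction n with
    | zero => simpa using hv
    | succ n ih => simpa only [iterate_succ_apply', pow_succ', mul_assoc] using step ih
  have hmaps : MapsTo (fun p : E × G => (p.1, p.2 * μ)) (range fun n : ℕ => (S^[n] v, g ^ n))
      (skewOrbitClosure S g u) := by
    rintro _ ⟨n, rfl⟩
    exact iter n
  exact (hmaps.closure (by fun_prop)).mono_right isClosed_skewOrbitClosure.closure_subset hw

/-- The fibre of `skewOrbitClosure S g u` over `u`. -/
def skewOrbitSubgroup [CompactSpace G] (hS : Continuous S) (g : G) (u : E) : Subgroup G where
  carrier := {μ | (u, μ) ∈ skewOrbitClosure S g u}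
  one_mem' := by simpa using iterate_mem_skewOrbitClosure (S := S) (g := g) (u := u) 0
  mul_mem' := fun ha hb => skewOrbitClosure_trans hS hb ha
  inv_mem' := fun {μ} hμ => by
    have hpow (n : ℕ) : (u, μ ^ n) ∈ skewOrbitClosure S g u := by
      induction n with
      | zero => simpa using iterate_mem_skewOrbitClosure (S := S) (g := g) (u := u) 0
      | succ n ih => simpa only [pow_succ] using skewOrbitClosure_trans hS hμ ih
    have hinv : μ⁻¹ ∈ closure (range fun n : ℕ => μ ^ n) := by
      rw [← closure_range_zpow_eq_pow]
      exact subset_closure ⟨-1, by simp⟩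
    have hcl : IsClosed {ν | (u, ν) ∈ skewOrbitClosure S g u} :=
      isClosed_skewOrbitClosure.preimage (by fun_prop)
    exact hcl.closure_subset_iff.2 (range_subset_iff.2 hpow) hinv

theorem mem_skewOrbitSubgroup [CompactSpace G] (hS : Continuous S) :
    μ ∈ skewOrbitSubgroup hS g u ↔ (u, μ) ∈ skewOrbitClosure S g u := Iff.rfl

theorem isClosed_skewOrbitSubgroup [CompactSpace G] (hS : Continuous S) :
    IsClosed (skewOrbitSubgroup hS g u : Set G) :=
  isClosed_skewOrbitClosure.preimage (f := fun μ : G => (u, μ)) (by fun_prop)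

end SkewOrbit

/-- If the points with dense orbit include an invariant contractible set through `x`, then the
return times of `x` to open sets can be taken along any prescribed rotation close to `1`. -/
theorem mem_skewOrbitClosure_one {E : Type*} [TopologicalSpace E] {S : E → E}
    (hS : Continuous S) {C : Set E} [ContractibleSpace C] (hSC : MapsTo S C C)
    (hC : ∀ y ∈ C, Dense (range fun n : ℕ => S^[n] y)) {x : E} (hx : x ∈ C) (g : Circle) (y : E) :
    (y, 1) ∈ skewOrbitClosure S g x := by
  set H := skewOrbitSubgroup hS g x
  suffices hg : g ∈ H by
    have hiter (n : ℕ) : (S^[n] x, 1) ∈ skewOrbitClosure S g x := by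
      have := skewOrbitClosure_trans hS ((mem_skewOrbitSubgroup hS).1 (H.inv_mem (H.pow_mem hg n)))
        (iterate_mem_skewOrbitClosure n)
      rwa [mul_inv_cancel] at this
    have hcl : IsClosed {z | (z, (1 : Circle)) ∈ skewOrbitClosure S g x} :=
      isClosed_skewOrbitClosure.preimage (by fun_prop)
    exact hcl.closure_subset_iff.2 (range_subset_iff.2 hiter) (hC x hx y)
  by_contra hg
  obtain ⟨m, hm, hgm⟩ := Circle.exists_zpow_ne_one_of_notMem (isClosed_skewOrbitSubgroup hS) hg
  have hunique {z : E} (hz : z ∈ C) {μ ν : Circle} (hμ : (z, μ) ∈ skewOrbitClosure S g x)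
      (hν : (z, ν) ∈ skewOrbitClosure S g x) : μ ^ m = ν ^ m := by
    obtain ⟨κ, hκ⟩ := exists_mem_skewOrbitClosure (g := g) (hC z hz) x
    have h₁ := hm _ (skewOrbitClosure_trans hS hμ hκ)
    have h₂ := hm _ (skewOrbitClosure_trans hS hν hκ)
    rw [mul_zpow] at h₁ h₂
    exact mul_left_cancel (h₁.trans h₂.symm)
  choose F hF using exists_mem_skewOrbitClosure (g := g) (hC x hx)
  have hcont : Continuous fun z : C => F z ^ m := by
    refine continuous_iff_isClosed.2 fun Z hZ => ?_
    have hcl : IsClosed (Prod.fst '' (skewOrbitClosure S g x ∩ {p | p.2 ^ m ∈ Z})) :=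
      isClosedMap_fst_of_compactSpace _ <| isClosed_skewOrbitClosure.inter
        (hZ.preimage (f := fun p : E × Circle => p.2 ^ m) (by fun_prop))
    convert hcl.preimage continuous_subtype_val using 1
    ext z
    constructor
    · exact fun hz => ⟨(z, F z), ⟨hF z, hz⟩, rfl⟩
    · rintro ⟨⟨_, μ⟩, ⟨hμ, hμZ⟩, rfl⟩
      rwa [mem_preimage, ← hunique z.2 hμ (hF z)]
  refine hgm (Circle.eq_one_of_eigenfunction hcont (S := hSC.restrict)
    (hS.restrict hSC) (c := g ^ m) (fun z => ?_) (a := ⟨x, hx⟩) ?_)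
  · rw [← mul_zpow]
    refine hunique (hSC z.2) (hF _) (skewOrbitClosure_trans hS (hF z) ?_)
    simpa using iterate_mem_skewOrbitClosure (S := S) (g := g) (u := (z : E)) 1
  · rw [closure_subtype, ← range_comp]
    convert hC _ (hSC hx) x using 3
    ext n
    rw [comp_apply, hSC.iterate_restrict, MapsTo.val_restrict_apply, iterate_succ_apply]

section Eigenfunctional

open Polynomial

variable {X : Type*} [NormedAddCommGroup X] [NormedSpace ℂ X] {T : X →L[ℂ] X} {x : X}

theorem eq_zero_of_weaklyDense_orbit
    (hx : Dense (range fun n : ℕ => (WeakSpace.map T)^[n] (toWeakSpace ℂ X x)))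
    {l : StrongDual ℂ X} {a : ℂ} (hl : ∀ y, l (T y) = a * l y) : l = 0 := by
  by_contra h0
  have hcont : Continuous fun y : WeakSpace ℂ X => l ((toWeakSpace ℂ X).symm y) :=
    WeakBilin.eval_continuous (topDualPairing ℂ X).flip l
  have hsurj : Surjective fun y : WeakSpace ℂ X => l ((toWeakSpace ℂ X).symm y) :=
    (LinearMap.surjective (f := (l : X →ₗ[ℂ] ℂ)) fun h =>
      h0 (ContinuousLinearMap.coe_injective h)).comp
      (toWeakSpace ℂ X).symm.surjective
  have hiter (n : ℕ) : l ((toWeakSpace ℂ X).symm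
      ((WeakSpace.map T)^[n] (toWeakSpace ℂ X x))) = a ^ n * l x := by
    induction n with
    | zero => rw [pow_zero, one_mul]; rfl
    | succ n ih =>
      rw [iterate_succ_apply', pow_succ', mul_assoc, ← ih]
      exact hl _
  have hd : Dense (range fun n : ℕ => a ^ n * l x) := by
    have := hsurj.denseRange.dense_image hcont hx
    rw [← range_comp] at this
    simpa only [comp_def, hiter] using this
  have hmem {Z : Set ℂ} (hZ : IsClosed Z) (h : ∀ n : ℕ, a ^ n * l x ∈ Z) (z : ℂ) : z ∈ Z :=
    hZ.closure_subset_iff.2 (range_subset_iff.2 h) (hd z)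
  have hsmall : ¬ ∀ n : ℕ, ‖a ^ n * l x‖ ≤ ‖l x‖ := fun h => by
    have := hmem (Z := {z | ‖z‖ ≤ ‖l x‖}) (isClosed_le (by fun_prop) (by fun_prop)) h
      ((‖l x‖ + 1 : ℝ) : ℂ)
    rw [mem_ofPred_eq, Complex.norm_real, Real.norm_of_nonneg (by positivity)] at this
    linarith
  rcases le_or_gt ‖a‖ 1 with ha | ha
  · refine hsmall fun n => ?_
    rw [norm_mul, norm_pow]
    exact mul_le_of_le_one_left (norm_nonneg _) (pow_le_one₀ (norm_nonneg _) ha)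
  · have h := hmem (Z := {z | ‖l x‖ ≤ ‖z‖}) (isClosed_le (by fun_prop) (by fun_prop))
      (fun n => by
        rw [mem_ofPred_eq, norm_mul, norm_pow]
        exact le_mul_of_one_le_left (norm_nonneg _) (one_le_pow₀ ha.le)) 0
    have hlx : l x = 0 := by simpa using h
    exact hsmall fun n => by simp [hlx]

theorem denseRange_sub_algebraMap_of_weaklyDense_orbit
    (hx : Dense (range fun n : ℕ => (WeakSpace.map T)^[n] (toWeakSpace ℂ X x))) (a : ℂ) :
    DenseRange (T - algebraMap ℂ (X →L[ℂ] X) a) := by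
  set A := T - algebraMap ℂ (X →L[ℂ] X) a with hA
  set P : Submodule ℂ X := (LinearMap.range (A : X →ₗ[ℂ] X)).topologicalClosure
  have hPc : IsClosed (P : Set X) := Submodule.isClosed_topologicalClosure _
  suffices hPt : P = ⊤ by
    exact Submodule.dense_iff_topologicalClosure_eq_top.2 hPt
  by_contra hne
  obtain ⟨v, hv⟩ : ∃ v, v ∉ P := by simpa [Submodule.eq_top_iff'] using hne
  obtain ⟨l, hl⟩ := SeparatingDual.exists_eq_one (R := ℂ) (x := P.mkQ v) (by simpa using hv)
  have hl0 : l.comp P.mkQL = 0 := by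
    refine eq_zero_of_weaklyDense_orbit hx (a := a) fun y => ?_
    have hy : A y ∈ P := Submodule.le_topologicalClosure _ ⟨y, rfl⟩
    have hq : P.mkQ (A y) = 0 := by simpa using hy
    have : l (P.mkQ (T y) - a • P.mkQ y) = 0 := by
      rw [← map_smul, ← map_sub]
      have hAy : T y - a • y = A y := by simp [hA, Algebra.algebraMap_eq_smul_one]
      rw [hAy, hq, map_zero]
    rw [map_sub, map_smul, sub_eq_zero] at this
    exact this
  have := congrArg (fun k : StrongDual ℂ X => k v) hl0
  exact one_ne_zero (hl.symm.trans this)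

theorem denseRange_aeval_of_weaklyDense_orbit
    (hx : Dense (range fun n : ℕ => (WeakSpace.map T)^[n] (toWeakSpace ℂ X x)))
    {p : ℂ[X]} (hp : p ≠ 0) : DenseRange (aeval T p) := by
  have hprod (s : Multiset ℂ) : DenseRange (aeval T (s.map fun a => Polynomial.X - C a).prod) := by
    induction s using Multiset.induction_on with
    | empty => simpa using denseRange_id
    | cons a s ih =>
      rw [Multiset.map_cons, Multiset.prod_cons, map_mul]
      have h := denseRange_sub_algebraMap_of_weaklyDense_orbit hx a
      simpa using h.comp ih (ContinuousLinearMap.continuous _)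
  rw [(IsAlgClosed.splits p).eq_prod_roots, map_mul, aeval_C]
  have hc : Surjective (algebraMap ℂ (X →L[ℂ] X) p.leadingCoeff) := fun y =>
    ⟨p.leadingCoeff⁻¹ • y, by
      simp [Algebra.algebraMap_eq_smul_one, smul_smul, leadingCoeff_ne_zero.2 hp]⟩
  exact hc.denseRange.comp (hprod _) (ContinuousLinearMap.continuous _)

theorem mem_skewOrbitClosure_weakSpaceMap
    (hx : Dense (range fun n : ℕ => (WeakSpace.map T)^[n] (toWeakSpace ℂ X x))) (g : Circle)
    (y : WeakSpace ℂ X) : (y, 1) ∈ skewOrbitClosure (WeakSpace.map T) g (toWeakSpace ℂ X x) := by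
  let C : Set (WeakSpace ℂ X) := {y | ∃ p : ℂ[X], p.eval 1 = 1 ∧ toWeakSpace ℂ X (aeval T p x) = y}
  have hconv : Convex ℝ C := by
    rintro _ ⟨p, hp, rfl⟩ _ ⟨q, hq, rfl⟩ s t - - hst
    refine ⟨(s : ℂ) • p + (t : ℂ) • q, ?_, ?_⟩
    · simp [hp, hq, ← Complex.ofReal_add, hst]
    · simp only [map_add, map_smul, _root_.add_apply, _root_.smul_apply]
      rfl
  have hxC : toWeakSpace ℂ X x ∈ C := ⟨1, by simp, by simp⟩
  have : ContinuousSMul ℝ (WeakSpace ℂ X) := IsScalarTower.continuousSMul ℂ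
  have := hconv.contractibleSpace ⟨_, hxC⟩
  refine mem_skewOrbitClosure_one (WeakSpace.map T).continuous (C := C) ?_ ?_ hxC g y
  · rintro _ ⟨p, hp, rfl⟩
    exact ⟨Polynomial.X * p, by simp [hp], by rw [map_mul, aeval_X]; rfl⟩
  · rintro _ ⟨p, hp, rfl⟩
    have hp0 : p ≠ 0 := by rintro rfl; simp at hp
    have hdense : DenseRange (WeakSpace.map (aeval T p)) :=
      (toWeakSpace ℂ X).surjective.denseRange.comp
        (denseRange_aeval_of_weaklyDense_orbit hx hp0) (toWeakSpaceCLM ℂ X).continuous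
    have hcomm : Function.Commute (WeakSpace.map (aeval T p)) (WeakSpace.map T) := fun z => by
      have h : aeval T p * T = T * aeval T p := by
        simpa using congrArg (aeval T) (mul_comm p Polynomial.X)
      exact congrArg (fun A : X →L[ℂ] X => A z) h
    have := hdense.dense_image (ContinuousLinearMap.continuous _) hx
    rw [← range_comp] at this
    convert this using 3 with n
    exact ((hcomm.iterate_right n) _).symm

end Eigenfunctional

/-- De La Rosa: if `T` is weakly hypercyclic on a complex Banach space, then every power
`T ^ n`, `n ≥ 1`, is weakly hypercyclic, and every unimodular multiple `λ • T` is weakly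
hypercyclic. -/
theorem weaklyHypercyclic_pow_and_unimodular_smul {X : Type*}
    [NormedAddCommGroup X] [NormedSpace ℂ X] [CompleteSpace X]
    (T : X →L[ℂ] X) (hT : WeaklyHypercyclic T) :
    (∀ n : ℕ, 1 ≤ n → WeaklyHypercyclic (T ^ n)) ∧
    (∀ lam : ℂ, ‖lam‖ = 1 → WeaklyHypercyclic (lam • T)) := by
  obtain ⟨x, hx⟩ := hT
  have hiter (n : ℕ) : (WeakSpace.map T)^[n] (toWeakSpace ℂ X x) = toWeakSpace ℂ X ((T ^ n) x) := by
    rw [FunLike.coe_pow_eq_iterate]; rfl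
  have hx' : Dense (range fun n : ℕ => (WeakSpace.map T)^[n] (toWeakSpace ℂ X x)) := by
    simp only [hiter]; exact hx
  have key := mem_skewOrbitClosure_weakSpaceMap hx'
  simp only [skewOrbitClosure, hiter] at key
  refine ⟨fun n hn => ⟨x, fun y => ?_⟩, fun lam hlam => ⟨x, fun y => ?_⟩⟩
  · obtain ⟨g, hg⟩ : ∃ g : Circle, IsPrimitiveRoot g n := by
      have h := Complex.isPrimitiveRoot_exp n (by lia)
      refine ⟨⟨_, mem_sphere_zero_iff_norm.2 (h.norm'_eq_one (by lia))⟩, ?_⟩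
      exact IsPrimitiveRoot.of_map_of_injective (f := Circle.coeHom) h Circle.coe_injective
    have hF : IsClosed ((fun j : ℕ => g ^ j) '' Ioo 0 n) := ((finite_Ioo 0 n).image _).isClosed
    rw [mem_closure_iff]
    intro U hU hyU
    obtain ⟨_, ⟨hkU, hkF⟩, k, rfl⟩ := mem_closure_iff.1 (key g y)
      (U ×ˢ ((fun j : ℕ => g ^ j) '' Ioo 0 n)ᶜ) (hU.prod hF.isOpen_compl)
      ⟨hyU, fun ⟨j, hj, hj1⟩ => hg.pow_ne_one_of_pos_of_lt hj.1.ne' hj.2 hj1⟩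
    obtain ⟨m, rfl⟩ : n ∣ k := by
      by_contra hnk
      refine hkF ⟨k % n, ⟨Nat.pos_of_ne_zero fun h => hnk (Nat.dvd_of_mod_eq_zero h),
        Nat.mod_lt _ hn⟩, ?_⟩
      exact hg.eq_orderOf ▸ pow_mod_orderOf g k
    exact ⟨_, hkU, m, congrArg (fun A : X →L[ℂ] X => toWeakSpace ℂ X (A x)) (pow_mul T n m).symm⟩
  · let g : Circle := ⟨lam, mem_sphere_zero_iff_norm.2 hlam⟩
    have hmaps : MapsTo (fun p : WeakSpace ℂ X × Circle => (p.2 : ℂ) • p.1)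
        (range fun n : ℕ => (toWeakSpace ℂ X ((T ^ n) x), g ^ n))
        (range fun n : ℕ => (show WeakSpace ℂ X from ((lam • T) ^ n) x)) := by
      rintro _ ⟨n, rfl⟩
      exact ⟨n, congrArg (fun A : X →L[ℂ] X => toWeakSpace ℂ X (A x)) (smul_pow lam T n)⟩
    simpa using hmaps.closure (by fun_prop) (key g y)
end

section
/- Let φ ∈ C₀[0,1) take values in [0,1). Then the following are equivalent: (i) φ is strictly increasing and φ(x) > x for all x ∈ (0,1); (ii) the Volterra composition operator V_φ is weakly hypercyclic on C₀[0,1); (iii) V_φ is hypercyclic on C₀[0,1). -/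
open Filter Topology

/-- The Fréchet space `C₀[0,1)` of continuous functions on `[0,1)` vanishing at `0`,
with the (compact-open) topology of uniform convergence on compact subsets of `[0,1)`,
as a submodule of `C([0,1), ℝ)`. -/
def CZero : Submodule ℝ C(↥(Set.Ico (0 : ℝ) 1), ℝ) where
  carrier := {f | f ⟨0, Set.mem_Ico.mpr ⟨le_refl 0, one_pos⟩⟩ = 0}
  add_mem' := by
    intro a b ha hb
    simp only [Set.mem_setOf_eq] at ha hb ⊢
    rw [ContinuousMap.add_apply, ha, hb, add_zero]
  zero_mem' := by
    simp only [Set.mem_setOf_eq]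
    rfl
  smul_mem' := by
    intro c a ha
    simp only [Set.mem_setOf_eq] at ha ⊢
    rw [ContinuousMap.smul_apply, ha, smul_zero]

section

open Set MeasureTheory

instance : LocallyCompactSpace (Ico (0 : ℝ) 1) :=
  (isLocallyClosed_Ico (a := (0 : ℝ)) (b := 1)).locallyCompactSpace

instance : PreconnectedSpace (Ico (0 : ℝ) 1) :=
  Subtype.preconnectedSpace isPreconnected_Ico

instance : CompactIccSpace (Ico (0 : ℝ) 1) where
  isCompact_Icc {a b} := by
    rw [Subtype.isCompact_iff, image_subtype_val_Icc]
    exact isCompact_Icc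

theorem exists_dense_orbit_of_transitive {E : Type*} [TopologicalSpace E] [BaireSpace E]
    [SecondCountableTopology E] [Nonempty E] {T : ℕ → E → E} (hT : ∀ n, Continuous (T n))
    (h : ∀ U W : Set E, IsOpen U → IsOpen W → U.Nonempty → W.Nonempty →
      ∃ n, ∃ x ∈ U, T n x ∈ W) :
    ∃ x, Dense (range fun n => T n x) := by
  have key : Dense (⋂ W ∈ TopologicalSpace.countableBasis E, ⋃ n, T n ⁻¹' W) := by
    refine dense_biInter_of_isOpen (fun W hW => ?_)
      (TopologicalSpace.countable_countableBasis E) (fun W hW => ?_)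
    · exact isOpen_iUnion fun n =>
        (TopologicalSpace.isOpen_of_mem_countableBasis hW).preimage (hT n)
    · rw [dense_iff_inter_open]
      intro U hU hUne
      obtain ⟨n, x, hxU, hx⟩ := h U W hU (TopologicalSpace.isOpen_of_mem_countableBasis hW) hUne
        (TopologicalSpace.nonempty_of_mem_countableBasis hW)
      exact ⟨x, hxU, mem_iUnion.2 ⟨n, hx⟩⟩
  obtain ⟨x, hx⟩ := key.nonempty
  refine ⟨x, (TopologicalSpace.isBasis_countableBasis E).dense_iff.2 fun W hW _ => ?_⟩
  obtain ⟨n, hn⟩ := mem_iUnion.1 (mem_iInter₂.1 hx W hW)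
  exact ⟨T n x, hn, n, rfl⟩

namespace CZero

/-- The origin of `[0,1)`. -/
def origin : Ico (0 : ℝ) 1 := ⟨0, mem_Ico.mpr ⟨le_refl 0, one_pos⟩⟩

theorem origin_le (x : Ico (0 : ℝ) 1) : origin ≤ x := x.2.1

theorem apply_origin (f : CZero) : f.1 origin = 0 := f.2

theorem isClosed : IsClosed (CZero : Set C(Ico (0 : ℝ) 1, ℝ)) :=
  isClosed_singleton.preimage (continuous_eval_const origin)

instance : CompleteSpace CZero := isClosed.completeSpace_coe

instance : BaireSpace CZero := by
  have : (uniformity CZero).IsCountablyGenerated := by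
    rw [uniformity_subtype]; infer_instance
  let := UniformSpace.pseudoMetricSpace CZero
  infer_instance

instance : SecondCountableTopology CZero :=
  TopologicalSpace.Subtype.secondCountableTopology (CZero : Set C(Ico (0 : ℝ) 1, ℝ))

theorem exists_le_of_isCompact {K : Set (Ico (0 : ℝ) 1)} (hK : IsCompact K) :
    ∃ b : Ico (0 : ℝ) 1, ∀ x ∈ K, x ≤ b := by
  rcases K.eq_empty_or_nonempty with rfl | hne
  · exact ⟨origin, by simp⟩
  · obtain ⟨b, -, hb⟩ := hK.exists_isGreatest hne
    exact ⟨b, fun x hx => hb hx⟩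

theorem tendsto_iff {ι : Type*} {p : Filter ι} {F : ι → CZero} {f : CZero} :
    Tendsto F p (𝓝 f) ↔ ∀ b : Ico (0 : ℝ) 1, ∀ ε > 0, ∀ᶠ i in p, ∀ x ≤ b,
      |(F i).1 x - f.1 x| < ε := by
  rw [tendsto_subtype_rng, ContinuousMap.tendsto_iff_forall_isCompact_tendstoUniformlyOn]
  constructor
  · intro h b ε hε
    have hc : IsCompact (Icc origin b) := isCompact_Icc
    filter_upwards [Metric.tendstoUniformlyOn_iff.1 (h _ hc) ε hε] with i hi x hx
    have := hi x ⟨origin_le x, hx⟩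
    rwa [dist_comm, Real.dist_eq] at this
  · intro h K hK
    obtain ⟨b, hb⟩ := exists_le_of_isCompact hK
    refine Metric.tendstoUniformlyOn_iff.2 fun ε hε => ?_
    filter_upwards [h b ε hε] with i hi x hx
    rw [dist_comm, Real.dist_eq]
    exact hi x (hb x hx)

theorem exists_forall_eq_imp_mem {f : CZero} {U : Set CZero} (hU : U ∈ 𝓝 f) :
    ∃ b : Ico (0 : ℝ) 1, ∀ h : CZero, (∀ x ≤ b, h.1 x = f.1 x) → h ∈ U := by
  by_contra! H
  choose F hF hFU using H
  have hlim : Tendsto F atTop (𝓝 f) := by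
    refine tendsto_iff.2 fun b ε hε => ?_
    filter_upwards [eventually_ge_atTop b] with c hc x hx
    rw [hF c x (hx.trans hc)]
    simpa using hε
  have : Nonempty (Ico (0 : ℝ) 1) := ⟨origin⟩
  obtain ⟨c, hc⟩ := (hlim.eventually_mem hU).exists
  exact hFU c hc

/-- Freezing the values of `f` from `b` on. -/
def truncate (f : CZero) (b : Ico (0 : ℝ) 1) : CZero :=
  ⟨⟨fun x => f.1 (min x b), by fun_prop⟩, by
    change f.1 (min origin b) = 0
    rw [min_eq_left (origin_le b), apply_origin]⟩

theorem exists_bounded_mem {U : Set CZero} (hU : IsOpen U) (hne : U.Nonempty) :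
    ∃ f ∈ U, ∃ M : ℝ, 0 ≤ M ∧ ∀ x, |f.1 x| ≤ M := by
  obtain ⟨f, hf⟩ := hne
  obtain ⟨b, hb⟩ := exists_forall_eq_imp_mem (hU.mem_nhds hf)
  refine ⟨truncate f b, hb _ fun x hx => congrArg f.1 (min_eq_left hx), ?_⟩
  obtain ⟨M, hM⟩ := (isCompact_Icc (a := origin) (b := b)).exists_bound_of_continuousOn
    f.1.continuous.continuousOn
  refine ⟨M, (norm_nonneg _).trans (hM origin ⟨le_rfl, origin_le b⟩), fun x => ?_⟩
  exact hM (min x b) ⟨origin_le _, min_le_right x b⟩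

/-- The functions vanishing on `[0,c]`. -/
def vanishing (c : Ico (0 : ℝ) 1) : Set CZero := {f | ∀ x ≤ c, f.1 x = 0}

theorem exists_tendsto_vanishing (g : CZero) :
    ∃ G : Ico (0 : ℝ) 1 → CZero, (∀ c, G c ∈ vanishing c) ∧ Tendsto G (𝓝 origin) (𝓝 g) := by
  let Γ : C(Ico (0 : ℝ) 1 × Ico (0 : ℝ) 1, ℝ) :=
    ⟨fun p => g.1 (max p.2 p.1) - g.1 p.1, by fun_prop⟩
  have hΓ : ∀ c, Γ.curry c ∈ CZero := fun c => by
    change g.1 (max origin c) - g.1 c = 0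
    rw [max_eq_right (origin_le c), sub_self]
  refine ⟨fun c => ⟨Γ.curry c, hΓ c⟩, fun c x hx => ?_, ?_⟩
  · change g.1 (max x c) - g.1 c = 0
    rw [max_eq_right hx, sub_self]
  · rw [tendsto_subtype_rng]
    have h0 : Γ.curry origin = g.1 := by
      ext x
      change g.1 (max x origin) - g.1 origin = g.1 x
      rw [max_eq_left (origin_le x), apply_origin, sub_zero]
    rw [← h0]
    exact Γ.curry.continuous.tendsto origin

/-- The extension of `f` to the real line by zero. -/
noncomputable def ext (f : CZero) (t : ℝ) : ℝ := if h : t ∈ Ico (0 : ℝ) 1 then f.1 ⟨t, h⟩ else 0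

theorem ext_coe (f : CZero) (x : Ico (0 : ℝ) 1) : ext f x = f.1 x := dif_pos x.2

theorem ext_of_nonpos (f : CZero) {t : ℝ} (ht : t ≤ 0) : ext f t = 0 := by
  rcases ht.lt_or_eq with ht | rfl
  · exact dif_neg fun h => ht.not_ge h.1
  · exact (ext_coe f origin).trans (apply_origin f)

theorem continuousOn_ext (f : CZero) : ContinuousOn (ext f) (Iio 1) := by
  rw [continuousOn_iff_continuous_domRestrict]
  have : (Iio (1 : ℝ)).domRestrict (ext f) = fun t : Iio (1 : ℝ) =>
      f.1 ⟨max t.1 0, le_max_right _ _, max_lt t.2 one_pos⟩ := by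
    funext t
    change ext f t.1 = _
    rcases le_total t.1 0 with ht | ht
    · rw [ext_of_nonpos f ht]
      simp only [max_eq_right ht]
      exact (apply_origin f).symm
    · simp only [max_eq_left ht]
      exact ext_coe f ⟨t.1, ht, t.2⟩
  rw [this]
  fun_prop

theorem intervalIntegrable_ext (f : CZero) {a b : ℝ} (ha : a < 1) (hb : b < 1) :
    IntervalIntegrable (ext f) volume a b :=
  ((continuousOn_ext f).mono fun _ ht => ht.2.trans_lt (max_lt ha hb)).intervalIntegrable

theorem ext_eq_zero_of_mem_vanishing {f : CZero} {c : Ico (0 : ℝ) 1} (hf : f ∈ vanishing c)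
    {t : ℝ} (ht : t ≤ c) : ext f t = 0 := by
  rcases le_total t 0 with h0 | h0
  · exact ext_of_nonpos f h0
  · exact (ext_coe f ⟨t, h0, ht.trans_lt c.2.2⟩).trans (hf _ ht)

/-- The backward difference quotient of `f` with step `δ`. -/
noncomputable def diffQuot (f : CZero) {δ : ℝ} (hδ : 0 < δ) : CZero :=
  ⟨⟨fun x => (ext f x - ext f (x - δ)) / δ, by
    refine Continuous.div_const (Continuous.sub ?_ ?_) δ
    · exact (continuousOn_ext f).comp_continuous continuous_subtype_val fun x => x.2.2
    · exact (continuousOn_ext f).comp_continuous (by fun_prop) fun x =>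
        show (x : ℝ) - δ < 1 by linarith [x.2.2]⟩, by
    change (ext f (0 : ℝ) - ext f (0 - δ)) / δ = 0
    rw [ext_of_nonpos f le_rfl, ext_of_nonpos f (by linarith)]
    simp⟩

theorem diffQuot_mem_vanishing {f : CZero} {c : Ico (0 : ℝ) 1} (hf : f ∈ vanishing c) {δ : ℝ}
    (hδ : 0 < δ) : diffQuot f hδ ∈ vanishing c := by
  intro x hx
  have hx' : (x : ℝ) ≤ c := hx
  change (ext f x - ext f (x - δ)) / δ = 0
  rw [ext_eq_zero_of_mem_vanishing hf hx', ext_eq_zero_of_mem_vanishing hf (by linarith)]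
  simp

theorem integral_ext_diffQuot (f : CZero) {δ : ℝ} (hδ : 0 < δ) (y : Ico (0 : ℝ) 1) :
    ∫ t in (0 : ℝ)..y, ext (diffQuot f hδ) t = (∫ t in ((y : ℝ) - δ)..y, ext f t) / δ := by
  have hy0 := y.2.1
  have hy1 := y.2.2
  have h1 : ∫ t in (0 : ℝ)..y, ext (diffQuot f hδ) t
      = ∫ t in (0 : ℝ)..y, (ext f t - ext f (t - δ)) / δ := by
    refine intervalIntegral.integral_congr fun t ht => ?_
    rw [uIcc_of_le hy0] at ht
    exact ext_coe _ ⟨t, ht.1, ht.2.trans_lt hy1⟩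
  have hi : IntervalIntegrable (fun t => ext f (t - δ)) volume 0 y := by
    have := (intervalIntegrable_ext f (a := 0 - δ) (b := y - δ) (by linarith)
      (by linarith)).comp_sub_right δ
    simpa using this
  have hzero : ∫ t in (0 : ℝ)..(-δ), ext f t = 0 := by
    refine (intervalIntegral.integral_congr (g := fun _ => (0 : ℝ)) fun t ht => ?_).trans
      intervalIntegral.integral_zero
    rw [uIcc_of_ge (by linarith)] at ht
    exact ext_of_nonpos f ht.2
  rw [h1, intervalIntegral.integral_div, intervalIntegral.integral_sub
    (intervalIntegrable_ext f one_pos hy1) hi, intervalIntegral.integral_comp_sub_right,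
    zero_sub, intervalIntegral.integral_interval_sub_interval_comm
    (intervalIntegrable_ext f one_pos hy1)
    (intervalIntegrable_ext f (by linarith) (by linarith))
    (intervalIntegrable_ext f one_pos (by linarith)), hzero, zero_sub,
    intervalIntegral.integral_symm, neg_neg]

theorem eventually_abs_integral_diffQuot_sub_lt (f : CZero) (b : Ico (0 : ℝ) 1) {ε : ℝ}
    (hε : 0 < ε) : ∃ η > 0, ∀ δ (hδ : 0 < δ), δ < η → ∀ y ≤ b,
      |(∫ t in (0 : ℝ)..y, ext (diffQuot f hδ) t) - f.1 y| < ε := by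
  have huc : UniformContinuousOn (ext f) (Icc (-1) b) :=
    isCompact_Icc.uniformContinuousOn_of_continuous
      ((continuousOn_ext f).mono fun t ht => ht.2.trans_lt b.2.2)
  obtain ⟨η, hη, H⟩ := Metric.uniformContinuousOn_iff.1 huc (ε / 2) (half_pos hε)
  refine ⟨min η 1, lt_min hη one_pos, fun δ hδ hδη y hyb => ?_⟩
  have hyb' : (y : ℝ) ≤ b := hyb
  have hy0 := y.2.1
  have hy1 := y.2.2
  have hδ1 : δ < 1 := hδη.trans_le (min_le_right _ _)
  have hδ2 : δ < η := hδη.trans_le (min_le_left _ _)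
  have hI : ∫ t in ((y : ℝ) - δ)..y, ext f t =
      (∫ t in ((y : ℝ) - δ)..y, (ext f t - ext f y)) + δ * ext f y := by
    rw [intervalIntegral.integral_sub (intervalIntegrable_ext f (by linarith) hy1)
      intervalIntegrable_const, intervalIntegral.integral_const, smul_eq_mul]
    ring
  have hbound := intervalIntegral.norm_integral_le_of_norm_le_const
    (f := fun t => ext f t - ext f y) (a := (y : ℝ) - δ) (b := y) (C := ε / 2) fun t ht => by
      rw [uIoc_of_le (by linarith)] at ht
      refine (H t ⟨by linarith [ht.1], by linarith [ht.2]⟩ y ⟨by linarith, hyb'⟩ ?_).le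
      rw [Real.dist_eq, abs_lt]
      constructor <;> linarith [ht.1, ht.2]
  rw [sub_sub_cancel, abs_of_pos hδ, Real.norm_eq_abs] at hbound
  rw [integral_ext_diffQuot, hI, add_div, mul_div_cancel_left₀ _ hδ.ne', ext_coe,
    add_sub_cancel_right, abs_div, abs_of_pos hδ, div_lt_iff₀ hδ, ← ext_coe]
  nlinarith

section Volterra

variable {φ : C(Ico (0 : ℝ) 1, Ico (0 : ℝ) 1)} {V : CZero →L[ℝ] CZero}

theorem abs_volterra_le (hV : ∀ f x, (V f).1 x = ∫ t in (0 : ℝ)..φ x, ext f t)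
    {f g : CZero} (h : ∀ x, |f.1 x| ≤ g.1 x) (x : Ico (0 : ℝ) 1) :
    |(V f).1 x| ≤ (V g).1 x := by
  rw [hV, hV, ← Real.norm_eq_abs]
  refine intervalIntegral.norm_integral_le_of_norm_le (φ x).2.1 (ae_of_all _ fun t ht => ?_)
    (intervalIntegrable_ext g one_pos (φ x).2.2)
  have hx : t ∈ Ico (0 : ℝ) 1 := ⟨ht.1.le, ht.2.trans_lt (φ x).2.2⟩
  rw [ext_coe f ⟨t, hx⟩, ext_coe g ⟨t, hx⟩]
  exact h _

theorem abs_volterra_pow_le (hV : ∀ f x, (V f).1 x = ∫ t in (0 : ℝ)..φ x, ext f t)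
    {f g : CZero} (h : ∀ x, |f.1 x| ≤ g.1 x) (n : ℕ) (x : Ico (0 : ℝ) 1) :
    |((V ^ n) f).1 x| ≤ ((V ^ n) g).1 x := by
  induction n generalizing x with
  | zero => exact h x
  | succ n ih =>
    rw [pow_succ']
    exact abs_volterra_le hV ih x

theorem abs_integral_ext_le {f : CZero} {M : ℝ} {a b : Ico (0 : ℝ) 1} (hab : a ≤ b)
    (h : ∀ x ≤ b, |f.1 x| ≤ M) : |∫ t in (a : ℝ)..b, ext f t| ≤ M * (b - a) := by
  have hab' : (a : ℝ) ≤ b := hab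
  have := intervalIntegral.norm_integral_le_of_norm_le_const (f := ext f) (a := a) (b := b)
    (C := M) fun t ht => by
      rw [uIoc_of_le hab'] at ht
      have hx : t ∈ Ico (0 : ℝ) 1 := ⟨a.2.1.trans ht.1.le, ht.2.trans_lt b.2.2⟩
      rw [ext_coe f ⟨t, hx⟩]
      exact h _ ht.2
  rwa [abs_of_nonneg (sub_nonneg.2 hab')] at this

theorem abs_volterra_le_const (hV : ∀ f x, (V f).1 x = ∫ t in (0 : ℝ)..φ x, ext f t)
    {f : CZero} {M : ℝ} {x : Ico (0 : ℝ) 1} (h : ∀ y ≤ φ x, |f.1 y| ≤ M) :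
    |(V f).1 x| ≤ M * φ x := by
  rw [hV]
  have := abs_integral_ext_le (origin_le (φ x)) h
  change |∫ t in (0 : ℝ)..φ x, ext f t| ≤ M * (φ x - 0) at this
  rwa [sub_zero] at this

theorem abs_volterra_pow_le_of_symbol_le {a : Ico (0 : ℝ) 1} {M : ℝ} {f : CZero}
    (hV : ∀ f x, (V f).1 x = ∫ t in (0 : ℝ)..φ x, ext f t) (hφ : ∀ x ≤ a, φ x ≤ a)
    (hf : ∀ x ≤ a, |f.1 x| ≤ M) (n : ℕ) : ∀ x ≤ a, |((V ^ n) f).1 x| ≤ M := by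
  have hM : 0 ≤ M := (abs_nonneg _).trans (hf a le_rfl)
  induction n with
  | zero => exact hf
  | succ n ih =>
    intro x hx
    rw [pow_succ']
    refine (abs_volterra_le_const hV fun y hy => ih y (hy.trans (hφ x hx))).trans ?_
    exact mul_le_of_le_one_right hM (φ x).2.2.le

/-- The symbol, viewed as an element of the space. -/
def symbol (φ : C(Ico (0 : ℝ) 1, Ico (0 : ℝ) 1)) (hφ0 : φ origin = origin) : CZero :=
  ⟨⟨fun x => (φ x : ℝ), by fun_prop⟩, congrArg Subtype.val hφ0⟩

theorem symbol_apply (hφ0 : φ origin = origin) (x : Ico (0 : ℝ) 1) :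
    (symbol φ hφ0).1 x = φ x := rfl

theorem volterra_pow_symbol_nonneg (hV : ∀ f x, (V f).1 x = ∫ t in (0 : ℝ)..φ x, ext f t)
    (hφ0 : φ origin = origin) (n : ℕ) (x : Ico (0 : ℝ) 1) :
    0 ≤ ((V ^ n) (symbol φ hφ0)).1 x :=
  (abs_nonneg _).trans (abs_volterra_pow_le hV (f := symbol φ hφ0) (g := symbol φ hφ0)
    (fun y => (abs_of_nonneg (a := (φ y : ℝ)) (φ y).2.1).le) n x)

theorem volterra_pow_symbol_antitone (hV : ∀ f x, (V f).1 x = ∫ t in (0 : ℝ)..φ x, ext f t)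
    (hφ0 : φ origin = origin) (x : Ico (0 : ℝ) 1) :
    Antitone fun n => ((V ^ n) (symbol φ hφ0)).1 x := by
  refine antitone_nat_of_succ_le fun n => ?_
  rw [pow_succ]
  refine (le_abs_self _).trans (abs_volterra_pow_le hV (fun y => ?_) n x)
  refine (abs_volterra_le_const hV (M := 1) fun z _ => ?_).trans_eq (one_mul _)
  rw [symbol_apply, abs_of_nonneg (φ z).2.1]
  exact (φ z).2.2.le

theorem volterra_pow_symbol_le_one (hV : ∀ f x, (V f).1 x = ∫ t in (0 : ℝ)..φ x, ext f t)
    (hφ0 : φ origin = origin) (n : ℕ) (x : Ico (0 : ℝ) 1) :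
    ((V ^ n) (symbol φ hφ0)).1 x ≤ 1 :=
  (volterra_pow_symbol_antitone hV hφ0 x (Nat.zero_le n)).trans (φ x).2.2.le

theorem volterra_pow_symbol_mono (hV : ∀ f x, (V f).1 x = ∫ t in (0 : ℝ)..φ x, ext f t)
    (hφ0 : φ origin = origin) (hφ : Monotone φ) (n : ℕ) :
    Monotone ((V ^ n) (symbol φ hφ0)).1 := by
  intro x y hxy
  have hle : (φ x : ℝ) ≤ φ y := hφ hxy
  cases n with
  | zero => exact hle
  | succ n =>
    rw [pow_succ']
    change (V ((V ^ n) (symbol φ hφ0))).1 x ≤ (V ((V ^ n) (symbol φ hφ0))).1 y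
    rw [hV, hV, ← sub_nonneg, intervalIntegral.integral_interval_sub_left
      (intervalIntegrable_ext _ one_pos (φ y).2.2) (intervalIntegrable_ext _ one_pos (φ x).2.2)]
    refine intervalIntegral.integral_nonneg hle fun t ht => ?_
    rw [ext_coe _ ⟨t, (φ x).2.1.trans ht.1, ht.2.trans_lt (φ y).2.2⟩]
    exact volterra_pow_symbol_nonneg hV hφ0 n _

theorem volterra_pow_succ_symbol_le (hV : ∀ f x, (V f).1 x = ∫ t in (0 : ℝ)..φ x, ext f t)
    (hφ0 : φ origin = origin) (hφ : Monotone φ) (n : ℕ) (x : Ico (0 : ℝ) 1) :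
    ((V ^ (n + 1)) (symbol φ hφ0)).1 x ≤ ((V ^ n) (symbol φ hφ0)).1 (φ x) * φ x := by
  rw [pow_succ']
  refine (le_abs_self _).trans (abs_volterra_le_const hV fun y hy => ?_)
  refine (abs_of_nonneg (volterra_pow_symbol_nonneg hV hφ0 n y)).trans_le ?_
  exact volterra_pow_symbol_mono hV hφ0 hφ n hy

theorem volterra_pow_succ_symbol_le_add (hV : ∀ f x, (V f).1 x = ∫ t in (0 : ℝ)..φ x, ext f t)
    (hφ0 : φ origin = origin) (hφ : Monotone φ) (n : ℕ) (x y : Ico (0 : ℝ) 1) :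
    ((V ^ (n + 1)) (symbol φ hφ0)).1 x ≤
      ((V ^ n) (symbol φ hφ0)).1 y * y + ((V ^ n) (symbol φ hφ0)).1 (φ x) * (1 - y) := by
  have hnn := volterra_pow_symbol_nonneg hV hφ0 n
  have hmono := volterra_pow_symbol_mono hV hφ0 hφ n
  rcases le_total (φ x) y with h | h
  · have h' : (φ x : ℝ) ≤ y := h
    refine (volterra_pow_succ_symbol_le hV hφ0 hφ n x).trans ?_
    have h1 := mul_le_mul (hmono h) h' (φ x).2.1 (hnn y)
    have h2 := mul_nonneg (hnn (φ x)) (sub_nonneg.2 y.2.2.le)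
    linarith
  · have hbound : ∀ b : Ico (0 : ℝ) 1, ∀ z ≤ b,
        |((V ^ n) (symbol φ hφ0)).1 z| ≤ ((V ^ n) (symbol φ hφ0)).1 b := fun b z hz => by
      rw [abs_of_nonneg (hnn z)]
      exact hmono hz
    have h1 := (le_abs_self _).trans (abs_integral_ext_le (origin_le y) (hbound y))
    have h2 := (le_abs_self _).trans (abs_integral_ext_le h (hbound (φ x)))
    change ∫ t in (0 : ℝ)..y, ext ((V ^ n) (symbol φ hφ0)) t ≤ _ * (y - 0) at h1
    rw [sub_zero] at h1
    have h3 : ((V ^ n) (symbol φ hφ0)).1 (φ x) * (φ x - y) ≤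
        ((V ^ n) (symbol φ hφ0)).1 (φ x) * (1 - y) :=
      mul_le_mul_of_nonneg_left (by linarith [(φ x).2.2]) (hnn _)
    rw [pow_succ']
    change (V ((V ^ n) (symbol φ hφ0))).1 x ≤ _
    rw [hV, ← intervalIntegral.integral_add_adjacent_intervals
      (intervalIntegrable_ext _ one_pos y.2.2) (intervalIntegrable_ext _ y.2.2 (φ x).2.2)]
    linarith

theorem tendsto_volterra_pow_symbol (hV : ∀ f x, (V f).1 x = ∫ t in (0 : ℝ)..φ x, ext f t)
    (hφ0 : φ origin = origin) (hφ : Monotone φ) (x : Ico (0 : ℝ) 1) :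
    Tendsto (fun n => ((V ^ n) (symbol φ hφ0)).1 x) atTop (𝓝 0) := by
  set w : ℕ → Ico (0 : ℝ) 1 → ℝ := fun n x => ((V ^ n) (symbol φ hφ0)).1 x
  have hnn : ∀ n x, 0 ≤ w n x := volterra_pow_symbol_nonneg hV hφ0
  have hlim : ∀ x, ∃ l, Tendsto (fun n => w n x) atTop (𝓝 l) := fun x =>
    ⟨_, tendsto_atTop_ciInf (volterra_pow_symbol_antitone hV hφ0 x)
      ⟨0, by rintro _ ⟨n, rfl⟩; exact hnn n x⟩⟩
  choose l hl using hlim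
  have hl0 : ∀ x, 0 ≤ l x := fun x => ge_of_tendsto' (hl x) fun n => hnn n x
  have hbdd : BddAbove (range l) := ⟨1, by
    rintro _ ⟨x, rfl⟩
    exact le_of_tendsto' (hl x) fun n => volterra_pow_symbol_le_one hV hφ0 n x⟩
  have hle : ∀ x, l x ≤ ⨆ z, l z := le_ciSup hbdd
  set L := ⨆ z, l z
  have : Nonempty (Ico (0 : ℝ) 1) := ⟨origin⟩
  let y : Ico (0 : ℝ) 1 := ⟨1 / 2, by norm_num, by norm_num⟩
  have hy : (y : ℝ) = 1 / 2 := rfl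
  have h1 : L ≤ l y * y + L * (1 - y) := ciSup_le fun x => by
    refine (le_of_tendsto_of_tendsto' ((tendsto_add_atTop_iff_nat 1).2 (hl x))
      (((hl y).mul_const _).add ((hl (φ x)).mul_const _))
      fun n => volterra_pow_succ_symbol_le_add hV hφ0 hφ n x y).trans ?_
    have := mul_le_mul_of_nonneg_right (hle (φ x)) (sub_nonneg.2 y.2.2.le)
    linarith
  have h2 : l y ≤ L * φ y := by
    refine (le_of_tendsto_of_tendsto' ((tendsto_add_atTop_iff_nat 1).2 (hl y))
      ((hl (φ y)).mul_const _)
      fun n => volterra_pow_succ_symbol_le hV hφ0 hφ n y).trans ?_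
    exact mul_le_mul_of_nonneg_right (hle _) (φ y).2.1
  rw [hy] at h1
  have hL : L ≤ 0 := by
    have := (φ y).2.2
    by_contra! hpos
    nlinarith
  have hx := hl x
  rwa [le_antisymm ((hle x).trans hL) (hl0 x)] at hx

theorem tendsto_volterra_pow_of_bounded
    (hV : ∀ f x, (V f).1 x = ∫ t in (0 : ℝ)..φ x, ext f t)
    (hφ0 : φ origin = origin) (hφ : Monotone φ) {f : CZero} {M : ℝ} (hM : 0 ≤ M)
    (hf : ∀ x, |f.1 x| ≤ M) : Tendsto (fun n => (V ^ n) f) atTop (𝓝 0) := by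
  rw [← tendsto_add_atTop_iff_nat 1, tendsto_iff]
  intro b ε hε
  have hlim := (tendsto_volterra_pow_symbol hV hφ0 hφ b).const_mul M
  rw [mul_zero] at hlim
  filter_upwards [hlim.eventually_lt_const hε] with n hn x hx
  refine lt_of_le_of_lt ?_ hn
  have h1 := abs_volterra_pow_le hV (f := V f) (g := M • symbol φ hφ0)
    (fun y => abs_volterra_le_const hV fun z _ => hf z) n x
  rw [map_smul] at h1
  have h2 := mul_le_mul_of_nonneg_left (volterra_pow_symbol_mono hV hφ0 hφ n hx) hM
  rw [pow_succ]
  change |((V ^ n) (V f)).1 x - 0| ≤ _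
  rw [sub_zero]
  exact h1.trans h2

theorem mem_closure_image_vanishing (hV : ∀ f x, (V f).1 x = ∫ t in (0 : ℝ)..φ x, ext f t)
    (e : Ico (0 : ℝ) 1 ≃o Ico (0 : ℝ) 1) (he : ∀ x, e x = φ x) (c : Ico (0 : ℝ) 1) {g : CZero}
    (hg : g ∈ vanishing (e.symm c)) : g ∈ closure (V '' vanishing c) := by
  have hc : e.symm origin = origin :=
    le_antisymm (e.symm_apply_le.2 (origin_le _)) (origin_le _)
  let G : CZero := ⟨⟨fun x => g.1 (e.symm x), g.1.continuous.comp e.symm.continuous⟩, by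
    change g.1 (e.symm origin) = 0
    rw [hc, apply_origin]⟩
  have hG : G ∈ vanishing c := fun x hx => hg _ (e.symm.monotone hx)
  have hδ : ∀ k : ℕ, 0 < 1 / ((k : ℝ) + 1) := fun k => by positivity
  refine mem_closure_of_tendsto (f := fun k => V (diffQuot G (hδ k))) (b := atTop)
    (tendsto_iff.2 fun b ε hε => ?_)
    (Eventually.of_forall fun k => ⟨_, diffQuot_mem_vanishing hG (hδ k), rfl⟩)
  obtain ⟨η, hη, H⟩ := eventually_abs_integral_diffQuot_sub_lt G (φ b) hε
  filter_upwards [tendsto_one_div_add_atTop_nhds_zero_nat.eventually_lt_const hη] with k hk x hx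
  have hGx : G.1 (φ x) = g.1 x := by
    change g.1 (e.symm (φ x)) = g.1 x
    rw [← he, e.symm_apply_apply]
  rw [hV, ← hGx]
  refine H _ (hδ k) hk _ ?_
  rw [← he, ← he]
  exact e.monotone hx

theorem mem_closure_image_pow_vanishing
    (hV : ∀ f x, (V f).1 x = ∫ t in (0 : ℝ)..φ x, ext f t)
    (e : Ico (0 : ℝ) 1 ≃o Ico (0 : ℝ) 1) (he : ∀ x, e x = φ x) (c : Ico (0 : ℝ) 1) (n : ℕ)
    {g : CZero} (hg : g ∈ vanishing (e.symm^[n] c)) : g ∈ closure ((V ^ n) '' vanishing c) := by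
  induction n generalizing g with
  | zero => exact subset_closure ⟨g, hg, rfl⟩
  | succ n ih =>
    rw [Function.iterate_succ_apply'] at hg
    have h1 : V '' vanishing (e.symm^[n] c) ⊆ closure ((V ^ (n + 1)) '' vanishing c) := by
      have h2 : (V ^ (n + 1)) '' vanishing c = V '' ((V ^ n) '' vanishing c) := by
        rw [image_image, pow_succ']
        rfl
      rw [h2]
      exact (image_mono fun f hf => ih hf).trans (image_closure_subset_closure_image V.continuous)
    exact closure_minimal h1 isClosed_closure (mem_closure_image_vanishing hV e he _ hg)

theorem tendsto_iterate_origin (e : Ico (0 : ℝ) 1 ≃o Ico (0 : ℝ) 1)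
    (he : ∀ x : Ico (0 : ℝ) 1, 0 < (x : ℝ) → x < e x) (c : Ico (0 : ℝ) 1) :
    Tendsto (fun n => e.symm^[n] c) atTop (𝓝 origin) := by
  have hle : ∀ x, e.symm x ≤ x := fun x => by
    rw [e.symm_apply_le]
    rcases (origin_le x).eq_or_lt with rfl | hx
    · exact origin_le _
    · exact (he x hx).le
  have hanti : Antitone fun n => ((e.symm^[n] c : Ico (0 : ℝ) 1) : ℝ) :=
    antitone_nat_of_succ_le fun n => by
      rw [Function.iterate_succ_apply']
      exact hle _
  have hlim := tendsto_atTop_ciInf hanti ⟨0, by rintro _ ⟨n, rfl⟩; exact (e.symm^[n] c).2.1⟩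
  set l := ⨅ n, ((e.symm^[n] c : Ico (0 : ℝ) 1) : ℝ)
  have hl : l ∈ Ico (0 : ℝ) 1 := ⟨ge_of_tendsto' hlim fun n => (e.symm^[n] c).2.1,
    (le_of_tendsto' hlim fun n => hanti (Nat.zero_le n)).trans_lt c.2.2⟩
  have hlim' : Tendsto (fun n => e.symm^[n] c) atTop (𝓝 ⟨l, hl⟩) := tendsto_subtype_rng.2 hlim
  have hfix : e.symm ⟨l, hl⟩ = ⟨l, hl⟩ := by
    refine tendsto_nhds_unique ((e.symm.continuous.tendsto _).comp hlim') ?_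
    refine ((tendsto_add_atTop_iff_nat 1).2 hlim').congr fun n => ?_
    exact Function.iterate_succ_apply' ..
  have h0 : (⟨l, hl⟩ : Ico (0 : ℝ) 1) = origin := by
    by_contra hne
    have := he ⟨l, hl⟩ ((origin_le _).lt_of_ne' hne)
    rw [e.symm_apply_eq] at hfix
    exact this.ne hfix
  rwa [h0] at hlim'

theorem exists_dense_orbit_volterra (hV : ∀ f x, (V f).1 x = ∫ t in (0 : ℝ)..φ x, ext f t)
    (hφ0 : φ origin = origin) (hφ : StrictMono φ)
    (hlt : ∀ x : Ico (0 : ℝ) 1, 0 < (x : ℝ) → x < φ x) :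
    ∃ f : CZero, Dense (range fun n : ℕ => (V ^ n) f) := by
  have hsurj : Function.Surjective φ := fun y => by
    refine mem_range_of_exists_le_of_exists_ge φ.continuous
      ⟨origin, hφ0.trans_le (origin_le y)⟩ ⟨y, ?_⟩
    rcases (origin_le y).eq_or_lt with rfl | hy
    · exact origin_le _
    · exact (hlt y hy).le
  let e := hφ.orderIsoOfSurjective φ hsurj
  have he : ∀ x, e x = φ x := fun x => rfl
  refine exists_dense_orbit_of_transitive (fun n => (V ^ n).continuous) ?_
  intro U W hU hW hUne hWne
  obtain ⟨f, hfU, M, hM, hf⟩ := exists_bounded_mem hU hUne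
  obtain ⟨b, hb⟩ := exists_forall_eq_imp_mem (hU.mem_nhds hfU)
  obtain ⟨g, hg⟩ := hWne
  obtain ⟨G, hGv, hG⟩ := exists_tendsto_vanishing g
  have hlim : Tendsto (fun n => (V ^ n) f + G (e.symm^[n] b)) atTop (𝓝 g) := by
    have := (tendsto_volterra_pow_of_bounded hV hφ0 hφ.monotone hM hf).add
      (hG.comp (tendsto_iterate_origin e hlt b))
    rwa [zero_add] at this
  obtain ⟨n, hn⟩ := (hlim.eventually_mem (hW.mem_nhds hg)).exists
  have hopen : IsOpen ((fun h => (V ^ n) f + h) ⁻¹' W) := hW.preimage (by fun_prop)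
  obtain ⟨_, hxW, h, hh, rfl⟩ := mem_closure_iff.1
    (mem_closure_image_pow_vanishing hV e he b n (hGv (e.symm^[n] b))) _ hopen hn
  refine ⟨n, f + h, hb _ fun x hx => ?_, ?_⟩
  · change f.1 x + h.1 x = f.1 x
    rw [hh x hx, add_zero]
  · rw [map_add]
    exact hxW

end Volterra

theorem _root_.mem_of_dense_weakSpace {E : Type*} [AddCommGroup E] [Module ℝ E]
    [TopologicalSpace E] {u : ℕ → E}
    (hu : Dense (range fun n => (show WeakSpace ℝ E from u n))) (l : E →L[ℝ] ℝ) {S : Set ℝ}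
    (hS : IsClosed S) (h : ∀ n, l (u n) ∈ S) (x : E) : l x ∈ S := by
  have hl : Continuous fun y : WeakSpace ℝ E => l y :=
    WeakBilin.eval_continuous (topDualPairing ℝ E).flip l
  have : closure (range fun n => (show WeakSpace ℝ E from u n)) ⊆
      (fun y : WeakSpace ℝ E => l y) ⁻¹' S :=
    closure_minimal (by rintro _ ⟨n, rfl⟩; exact h n) (hS.preimage hl)
  exact this (hu x)

/-- Evaluation at a point, as a continuous linear functional. -/
noncomputable def evalCLM (x : Ico (0 : ℝ) 1) : CZero →L[ℝ] ℝ :=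
  (ContinuousMap.evalCLM ℝ x).comp CZero.subtypeL

theorem evalCLM_apply (x : Ico (0 : ℝ) 1) (f : CZero) : evalCLM x f = f.1 x := rfl

/-- The linear function with slope `c`. -/
def linear (c : ℝ) : CZero := ⟨⟨fun x => c * x, by fun_prop⟩, mul_zero c⟩

theorem linear_apply (c : ℝ) (x : Ico (0 : ℝ) 1) : (linear c).1 x = c * x := rfl

section Volterra

variable {φ : C(Ico (0 : ℝ) 1, Ico (0 : ℝ) 1)} {V : CZero →L[ℝ] CZero} {f : CZero}

theorem injective_of_dense_weakSpace (hV : ∀ f x, (V f).1 x = ∫ t in (0 : ℝ)..φ x, ext f t)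
    (hf : Dense (range fun n : ℕ => (show WeakSpace ℝ CZero from (V ^ n) f))) :
    Function.Injective φ := by
  intro x y hxy
  by_contra hne
  let l := evalCLM x - evalCLM y
  have hl : ∀ g, l g = g.1 x - g.1 y := fun g => rfl
  have hmem := mem_of_dense_weakSpace hf l (S := {l f, 0}) (toFinite _).isClosed fun n => by
    cases n with
    | zero => exact Or.inl rfl
    | succ n =>
      refine Or.inr ?_
      rw [pow_succ', hl]
      change (V ((V ^ n) f)).1 x - (V ((V ^ n) f)).1 y = 0
      rw [hV, hV, hxy, sub_self]
  have hd : (x : ℝ) - y ≠ 0 := sub_ne_zero.2 fun h => hne (Subtype.ext h)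
  have hg := hmem (linear ((|l f| + 1) / (x - y)))
  have hval : l (linear ((|l f| + 1) / (x - y))) = |l f| + 1 := by
    rw [hl (linear _), linear_apply, linear_apply, ← mul_sub, div_mul_cancel₀ _ hd]
  rw [hval] at hg
  rcases hg with hg | hg
  · linarith [le_abs_self (l f)]
  · have : |l f| + 1 = 0 := hg
    linarith [abs_nonneg (l f)]

theorem strictMono_of_injective (hφ0 : φ origin = origin) (hφ : Function.Injective φ) :
    StrictMono φ := by
  have : Inhabited (Ico (0 : ℝ) 1) := ⟨origin⟩
  rcases φ.continuous.strictMono_of_inj hφ with h | h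
  · exact h
  · have hlt : origin < (⟨1 / 2, by norm_num, by norm_num⟩ : Ico (0 : ℝ) 1) :=
      show (0 : ℝ) < 1 / 2 by norm_num
    have := h hlt
    rw [hφ0] at this
    exact absurd this (origin_le _).not_gt

theorem lt_symbol_of_dense_weakSpace (hV : ∀ f x, (V f).1 x = ∫ t in (0 : ℝ)..φ x, ext f t)
    (hφ : Monotone φ)
    (hf : Dense (range fun n : ℕ => (show WeakSpace ℝ CZero from (V ^ n) f)))
    (a : Ico (0 : ℝ) 1) (ha : 0 < (a : ℝ)) : a < φ a := by
  by_contra! hle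
  obtain ⟨M, hM⟩ := (isCompact_Icc (a := origin) (b := a)).exists_bound_of_continuousOn
    f.1.continuous.continuousOn
  have horbit := abs_volterra_pow_le_of_symbol_le hV (fun x hx => (hφ hx).trans hle)
    (fun x hx => hM x ⟨origin_le x, hx⟩)
  have := mem_of_dense_weakSpace hf (evalCLM a) (isClosed_Iic (a := M))
    (fun n => (le_abs_self _).trans (horbit n a le_rfl)) (linear ((M + 1) / a))
  rw [evalCLM_apply, linear_apply, div_mul_cancel₀ _ ha.ne', mem_Iic] at this
  linarith

end Volterra

end CZero

end

/-- Montes-Rodríguez et al.: for `φ ∈ C₀[0,1)` with values in `[0,1)` and the Volterra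
composition operator `V_φ` on `C₀[0,1)`, `(V_φ f)(x) = ∫₀^{φ(x)} f(t) dt`, the following
are equivalent: (i) `φ` is strictly increasing with `φ(x) > x` on `(0,1)`;
(ii) `V_φ` is weakly hypercyclic; (iii) `V_φ` is hypercyclic. -/
theorem volterra_composition_hypercyclic_iff
    (φ : C(↥(Set.Ico (0 : ℝ) 1), ↥(Set.Ico (0 : ℝ) 1)))
    (hφ0 : ((φ ⟨0, Set.mem_Ico.mpr ⟨le_refl 0, one_pos⟩⟩ : ↥(Set.Ico (0 : ℝ) 1)) : ℝ) = 0)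
    (V : CZero →L[ℝ] CZero)
    (hV : ∀ (f : CZero) (x : ↥(Set.Ico (0 : ℝ) 1)),
      ((V f : C(↥(Set.Ico (0 : ℝ) 1), ℝ)) x) =
        ∫ t in (0 : ℝ)..((φ x : ↥(Set.Ico (0 : ℝ) 1)) : ℝ),
          if h : t ∈ Set.Ico (0 : ℝ) 1 then (f : C(↥(Set.Ico (0 : ℝ) 1), ℝ)) ⟨t, h⟩
          else 0) :
    ((StrictMono φ ∧ ∀ x : ↥(Set.Ico (0 : ℝ) 1), 0 < (x : ℝ) →
        (x : ℝ) < ((φ x : ↥(Set.Ico (0 : ℝ) 1)) : ℝ)) ↔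
      ∃ f : CZero,
        Dense (Set.range fun n : ℕ => (show WeakSpace ℝ CZero from ((V ^ n) f)))) ∧
    ((∃ f : CZero,
        Dense (Set.range fun n : ℕ => (show WeakSpace ℝ CZero from ((V ^ n) f)))) ↔
      ∃ f : CZero, Dense (Set.range fun n : ℕ => ((V ^ n) f))) := by
  have hV' : ∀ f x, (V f).1 x = ∫ t in (0 : ℝ)..φ x, CZero.ext f t := hV
  have hφ0' : φ CZero.origin = CZero.origin := Subtype.ext hφ0
  have h_weak : (∃ f : CZero,
        Dense (Set.range fun n : ℕ => (show WeakSpace ℝ CZero from ((V ^ n) f)))) →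
      StrictMono φ ∧ ∀ x : ↥(Set.Ico (0 : ℝ) 1), 0 < (x : ℝ) →
        (x : ℝ) < ((φ x : ↥(Set.Ico (0 : ℝ) 1)) : ℝ) := by
    rintro ⟨f, hf⟩
    have hmono := CZero.strictMono_of_injective hφ0' (CZero.injective_of_dense_weakSpace hV' hf)
    exact ⟨hmono, CZero.lt_symbol_of_dense_weakSpace hV' hmono.monotone hf⟩
  have h_strong : (∃ f : CZero, Dense (Set.range fun n : ℕ => ((V ^ n) f))) →
      ∃ f : CZero,
        Dense (Set.range fun n : ℕ => (show WeakSpace ℝ CZero from ((V ^ n) f))) := by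
    rintro ⟨f, hf⟩
    exact ⟨f, (toWeakSpaceCLM_bijective (𝕜 := ℝ) (E := CZero)).surjective.denseRange.comp hf
      (toWeakSpaceCLM ℝ CZero).continuous⟩
  have h_orbit := fun h : StrictMono φ ∧ ∀ x : ↥(Set.Ico (0 : ℝ) 1), 0 < (x : ℝ) →
      (x : ℝ) < ((φ x : ↥(Set.Ico (0 : ℝ) 1)) : ℝ) =>
    CZero.exists_dense_orbit_volterra hV' hφ0' h.1 h.2
  exact ⟨⟨fun h => h_strong (h_orbit h), h_weak⟩, fun h => h_orbit (h_weak h), h_strong⟩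
end

section
/- For every integer n ≥ 1: (a) there exists a hypercyclic (n+1)-tuple of pairwise commuting linear operators on ℂⁿ, and (b) no n-tuple of pairwise commuting linear operators on ℂⁿ is hypercyclic; i.e. the minimal cardinality of a hypercyclic tuple of operators on ℂⁿ is n+1. -/
open Filter Topology

/-- A tuple `(T 0, …, T (m-1))` of commuting linear operators is hypercyclic if some
vector has a dense semigroup orbit `{T 0 ^ k 0 ∘ ⋯ ∘ T (m-1) ^ k (m-1) x}`. -/
def TupleHypercyclic {m n : ℕ} (T : Fin m → Module.End ℂ (Fin n → ℂ)) : Prop :=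
  ∃ x : Fin n → ℂ,
    Dense {y : Fin n → ℂ | ∃ k : Fin m → ℕ, y = ((List.ofFn fun i => T i ^ k i).prod) x}

open NormedSpace in
theorem exp_mul_exp_neg_self {A : Type*} [NormedCommRing A] [NormedAlgebra ℚ A]
    [CompleteSpace A] (a : A) : exp a * exp (-a) = 1 := by
  rw [← exp_add, add_neg_cancel, exp_zero]

open NormedSpace in
theorem algebraMap_mem_range_exp {A : Type*} [NormedRing A] [NormedAlgebra ℂ A]
    {c : ℂ} (hc : c ≠ 0) :
    algebraMap ℂ A c ∈ Set.range (exp : A → A) := by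
  refine ⟨algebraMap ℂ A (Complex.log c), ?_⟩
  rw [← algebraMap_exp_comm, ← Complex.exp_eq_exp_ℂ, Complex.exp_log hc]

theorem finite_spectrum_of_finiteDimensional {A : Type*} [Ring A] [Algebra ℂ A]
    [FiniteDimensional ℂ A] (a : A) :
    (spectrum ℂ a).Finite := by
  refine (Module.End.finite_spectrum (Algebra.lmul ℂ A a)).subset fun z hz => ?_
  rw [spectrum.mem_iff] at hz ⊢
  contrapose! hz
  have h : algebraMap ℂ (Module.End ℂ A) z - Algebra.lmul ℂ A a =
      Algebra.lmul ℂ A (algebraMap ℂ A z - a) := by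
    rw [map_sub, AlgHom.commutes]
  rw [h, Module.End.isUnit_iff] at hz
  obtain ⟨b, hb⟩ := hz.2 1
  have hb : (algebraMap ℂ A z - a) * b = 1 := hb
  have hba : b * (algebraMap ℂ A z - a) = 1 :=
    hz.1 (by
      change (algebraMap ℂ A z - a) * (b * (algebraMap ℂ A z - a)) = (algebraMap ℂ A z - a) * 1
      rw [← mul_assoc, hb, one_mul, mul_one])
  exact ⟨⟨_, b, hb, hba⟩, rfl⟩

section CommutativeBanachAlgebra

variable {A : Type*} [NormedCommRing A] [NormedAlgebra ℂ A] [NormedAlgebra ℚ A]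
  [CompleteSpace A]

open NormedSpace in
theorem isOpenMap_exp : IsOpenMap (exp : A → A) := by
  refine IsOpenMap.of_nhds_le fun x => ?_
  refine ((hasStrictFDerivAt_exp (𝕂 := ℂ) (x := x)).map_nhds_eq_of_surj ?_).ge
  refine LinearMap.range_eq_top.2 fun y => ⟨exp (-x) * y, ?_⟩
  change exp x * (exp (-x) * y) = y
  rw [← mul_assoc, exp_mul_exp_neg_self, one_mul]

open NormedSpace in
theorem isOpen_range_exp : IsOpen (Set.range (exp : A → A)) :=
  isOpenMap_exp.isOpen_range

open NormedSpace in
/-- The range of the exponential is relatively closed in the group of units. -/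
theorem mem_range_exp_of_mem_closure {b : A} (hb : IsUnit b)
    (h : b ∈ closure (Set.range (exp : A → A))) : b ∈ Set.range (exp : A → A) := by
  obtain ⟨u, rfl⟩ := hb
  have ho : IsOpen ((fun y : A => (↑u⁻¹ : A) * y) ⁻¹' Set.range exp) :=
    isOpen_range_exp.preimage (continuous_const.mul continuous_id)
  have hmem : (u : A) ∈ (fun y : A => (↑u⁻¹ : A) * y) ⁻¹' Set.range exp :=
    ⟨0, by simp⟩
  obtain ⟨y, ⟨c, hc⟩, d, rfl⟩ := mem_closure_iff.1 h _ ho hmem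
  have h1 : (u : A) * exp c = exp d := by simpa using congrArg (fun y => (u : A) * y) hc
  refine ⟨d + -c, ?_⟩
  rw [exp_add, ← h1, mul_assoc, exp_mul_exp_neg_self, mul_one]

open NormedSpace in
theorem mem_range_exp_of_isUnit [FiniteDimensional ℂ A] {a : A} (ha : IsUnit a) :
    a ∈ Set.range (exp : A → A) := by
  let s : Set A := (fun z : ℂ => algebraMap ℂ A z - a) '' (spectrum ℂ a)ᶜ
  have hcont : Continuous fun z : ℂ => algebraMap ℂ A z - a :=
    (continuous_algebraMap ℂ A).sub continuous_const
  have hconn : IsPreconnected s :=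
    ((finite_spectrum_of_finiteDimensional a).countable.isConnected_compl_of_one_lt_rank
      (by simp)).isPreconnected.image _ hcont.continuousOn
  have hne : (s ∩ Set.range (exp : A → A)).Nonempty := by
    have h1 : (1 : A) ∈ Set.range (exp : A → A) := ⟨0, exp_zero⟩
    have hlim : Tendsto (fun z : ℂ => (1 : A) - algebraMap ℂ A z * a) (𝓝[≠] 0) (𝓝 1) := by
      have : Continuous fun z : ℂ => (1 : A) - algebraMap ℂ A z * a :=
        continuous_const.sub ((continuous_algebraMap ℂ A).mul continuous_const)
      simpa using (this.tendsto 0).mono_left nhdsWithin_le_nhds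
    obtain ⟨z, hz, hz0⟩ := ((hlim.eventually (isOpen_range_exp.mem_nhds h1)).and
      self_mem_nhdsWithin).exists
    have hz0 : z ≠ 0 := hz0
    obtain ⟨c, hc⟩ := hz
    obtain ⟨d, hd⟩ := algebraMap_mem_range_exp (A := A) (inv_ne_zero hz0)
    have hdc : exp (d + c) = algebraMap ℂ A z⁻¹ - a := by
      rw [exp_add, hc, hd, mul_sub, mul_one, ← mul_assoc, ← map_mul, inv_mul_cancel₀ hz0,
        map_one, one_mul]
    refine ⟨algebraMap ℂ A z⁻¹ - a, ⟨z⁻¹, ?_, rfl⟩, d + c, hdc⟩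
    rw [Set.mem_compl_iff, spectrum.notMem_iff, ← hdc]
    exact isUnit_exp _
  have hcl : closure (Set.range (exp : A → A)) ∩ s ⊆ Set.range exp := by
    rintro _ ⟨hb, z, hz, rfl⟩
    exact mem_range_exp_of_mem_closure (spectrum.notMem_iff.1 hz) hb
  have hsub := hconn.subset_of_closure_inter_subset isOpen_range_exp hne hcl
  have h0 : -a ∈ s := ⟨0, spectrum.notMem_iff.2 (by simpa using ha.neg), by simp⟩
  obtain ⟨c, hc⟩ := hsub h0
  obtain ⟨d, hd⟩ := algebraMap_mem_range_exp (A := A) (c := -1) (by simp)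
  exact ⟨c + d, by rw [exp_add, hc, hd]; simp⟩

variable (A) in
/-- The real span of the kernel of the exponential. -/
noncomputable def expKernelSpan : Submodule ℝ A :=
  Submodule.span ℝ {a : A | NormedSpace.exp a = 1}

open NormedSpace in
theorem exp_smul_bounded_of_mem_expKernelSpan {w : A} (hw : w ∈ expKernelSpan A) :
    ∃ C : ℝ, ∀ s : ℝ, ‖exp (s • w)‖ ≤ C := by
  induction hw using Submodule.span_induction with
  | mem a ha =>
    have hcont : Continuous fun s : ℝ => exp (s • a) :=
      exp_continuous.comp (continuous_id.smul continuous_const)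
    obtain ⟨C, hC⟩ := (isCompact_Icc (a := (0 : ℝ)) (b := 1)).exists_bound_of_continuousOn
      hcont.continuousOn
    have hnat (n : ℕ) (b : A) (hb : exp b = 1) : exp ((n : ℝ) • b) = 1 := by
      rw [Nat.cast_smul_eq_nsmul, exp_nsmul, hb, one_pow]
    have ha' : exp (-a) = 1 := by
      have := exp_mul_exp_neg_self a
      rwa [show exp a = 1 from ha, one_mul] at this
    have hint (n : ℤ) : exp ((n : ℝ) • a) = 1 := by
      obtain ⟨m, rfl | rfl⟩ := n.eq_nat_or_neg
      · simpa using hnat m a ha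
      · simpa using hnat m (-a) ha'
    refine ⟨C, fun s => ?_⟩
    rw [← Int.floor_add_fract s, add_smul, exp_add, hint, one_mul]
    exact hC _ ⟨Int.fract_nonneg s, (Int.fract_lt_one s).le⟩
  | zero => exact ⟨‖(1 : A)‖, fun s => by simp⟩
  | add x y _ _ hx hy =>
    obtain ⟨C, hC⟩ := hx
    obtain ⟨D, hD⟩ := hy
    refine ⟨C * D, fun s => ?_⟩
    rw [smul_add, exp_add]
    exact (norm_mul_le _ _).trans
      (mul_le_mul (hC s) (hD s) (norm_nonneg _) ((norm_nonneg _).trans (hC s)))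
  | smul c x _ hx =>
    obtain ⟨C, hC⟩ := hx
    exact ⟨C, fun s => by rw [smul_smul]; exact hC _⟩

open NormedSpace in
theorem eq_zero_of_mem_expKernelSpan_of_I_smul_mem {w : A} (hw : w ∈ expKernelSpan A)
    (hw' : Complex.I • w ∈ expKernelSpan A) : w = 0 := by
  obtain ⟨C, hC⟩ := exp_smul_bounded_of_mem_expKernelSpan hw
  obtain ⟨D, hD⟩ := exp_smul_bounded_of_mem_expKernelSpan hw'
  have hder (z : ℂ) := hasDerivAt_exp_smul_const (𝕂 := ℂ) w z
  have hbdd : Bornology.IsBounded (Set.range fun z : ℂ => exp (z • w)) := by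
    refine isBounded_iff_forall_norm_le.2 ⟨C * D, ?_⟩
    rintro _ ⟨z, rfl⟩
    have hz : z • w = z.re • w + z.im • (Complex.I • w) := by
      conv_lhs => rw [← Complex.re_add_im z, add_smul, mul_smul]
      simp only [Complex.coe_smul]
    change ‖exp (z • w)‖ ≤ _
    rw [hz, exp_add]
    exact (norm_mul_le _ _).trans
      (mul_le_mul (hC _) (hD _) (norm_nonneg _) ((norm_nonneg _).trans (hC 0)))
  have hconst : (fun z : ℂ => exp (z • w)) = fun _ => 1 := by
    funext z
    have hd : Differentiable ℂ fun z : ℂ => exp (z • w) := fun z => (hder z).differentiableAt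
    simpa using hd.apply_eq_apply_of_bounded hbdd z 0
  have h0 := hder 0
  rw [hconst] at h0
  simpa using h0.unique (hasDerivAt_const (0 : ℂ) (1 : A))

theorem finrank_expKernelSpan_le [FiniteDimensional ℂ A] :
    Module.finrank ℝ (expKernelSpan A) ≤ Module.finrank ℂ A := by
  have : FiniteDimensional ℝ A := FiniteDimensional.complexToReal A
  let J : A ≃ₗ[ℝ] A :=
    (LinearEquiv.smulOfNeZero ℂ A Complex.I Complex.I_ne_zero).restrictScalars ℝ
  have hdisj : Disjoint (expKernelSpan A) ((expKernelSpan A).map (J : A →ₗ[ℝ] A)) := by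
    refine Submodule.disjoint_def.2 ?_
    rintro _ hx ⟨w, hw, rfl⟩
    rw [eq_zero_of_mem_expKernelSpan_of_I_smul_mem hw hx]
    simp
  have h := Submodule.finrank_add_finrank_le_of_disjoint hdisj
  rw [LinearEquiv.finrank_map_eq, finrank_real_of_complex] at h
  omega

end CommutativeBanachAlgebra

/-- At most `finrank V - finrank K` vectors have nonnegative values under some nonzero linear
functional vanishing on `K`. -/
theorem exists_dual_ne_zero_nonneg {V : Type*} [AddCommGroup V] [Module ℝ V]
    [FiniteDimensional ℝ V] (K : Submodule ℝ V) {ι : Type*} [Fintype ι] [Nonempty ι]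
    (a : ι → V) (hcard : Module.finrank ℝ K + Fintype.card ι ≤ Module.finrank ℝ V) :
    ∃ g : V →ₗ[ℝ] ℝ, g ≠ 0 ∧ (∀ x ∈ K, g x = 0) ∧ ∀ i, 0 ≤ g (a i) := by
  classical
  by_cases htop : K ⊔ Submodule.span ℝ (Set.range a) = ⊤
  · have hspan : ⊤ ≤ Submodule.span ℝ (Set.range (K.mkQ ∘ a)) := by
      rw [Set.range_comp, ← Submodule.map_span]
      have h := congrArg (Submodule.map K.mkQ) htop
      rw [Submodule.map_sup, Submodule.map_top, Submodule.range_mkQ, Submodule.mkQ_map_self,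
        bot_sup_eq] at h
      exact h.ge
    have hq := K.finrank_quotient_add_finrank
    have hle : Module.finrank ℝ (V ⧸ K) ≤ Fintype.card ι := by
      have h := finrank_range_le_card (R := ℝ) (K.mkQ ∘ a)
      rwa [Set.finrank, top_le_iff.1 hspan, finrank_top] at h
    let b := basisOfTopLeSpanOfCardEqFinrank (K.mkQ ∘ a) hspan (by omega)
    have hb (i : ι) : b i = K.mkQ (a i) :=
      congrFun (coe_basisOfTopLeSpanOfCardEqFinrank (K.mkQ ∘ a) hspan (by omega)) i
    obtain ⟨i₀⟩ := ‹Nonempty ι›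
    have hg (i : ι) : (b.coord i₀ ∘ₗ K.mkQ) (a i) = if i = i₀ then 1 else 0 := by
      rw [LinearMap.comp_apply, ← hb, Module.Basis.coord_apply, Module.Basis.repr_self,
        Finsupp.single_apply]
    refine ⟨b.coord i₀ ∘ₗ K.mkQ, fun h => ?_, fun x hx => ?_, fun i => ?_⟩
    · have := hg i₀
      simp [h] at this
    · rw [LinearMap.comp_apply, Submodule.mkQ_apply, (Submodule.Quotient.mk_eq_zero K).2 hx,
        map_zero]
    · rw [hg]
      split_ifs <;> norm_num
  · obtain ⟨g, hg0, hg⟩ := Submodule.exists_le_ker_of_lt_top _ (lt_top_iff_ne_top.2 htop)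
    refine ⟨g, hg0, fun x hx => hg (Submodule.mem_sup_left hx), fun i => ?_⟩
    exact (hg (Submodule.mem_sup_right (Submodule.subset_span ⟨i, rfl⟩))).ge

open NormedSpace in
/-- A multiplicative semigroup with at most `finrank ℂ A` generators is not dense in `A`. -/
theorem not_dense_range_prod_pow {A : Type*} [NormedCommRing A] [NormedAlgebra ℂ A]
    [FiniteDimensional ℂ A] {ι : Type*} [Fintype ι] [Nonempty ι]
    (hcard : Fintype.card ι ≤ Module.finrank ℂ A) (t : ι → A) :
    ¬Dense (Set.range fun k : ι → ℕ => ∏ i, t i ^ k i) := by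
  classical
  intro hdense
  let _ : NormedAlgebra ℚ A := NormedAlgebra.restrictScalars ℚ ℂ A
  have : CompleteSpace A := FiniteDimensional.complete ℂ A
  have : FiniteDimensional ℝ A := FiniteDimensional.complexToReal A
  choose! l hl using fun (a : A) (ha : IsUnit a) => mem_range_exp_of_isUnit ha
  obtain ⟨g, hg0, hgK, hga⟩ := exists_dual_ne_zero_nonneg (expKernelSpan A) (fun i => l (t i)) (by
    have := finrank_expKernelSpan_le (A := A)
    rw [finrank_real_of_complex]
    omega)
  have hgcont : Continuous g := g.continuous_of_finiteDimensional
  have hopen : IsOpen (exp '' {a : A | g a < 0}) :=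
    isOpenMap_exp _ (isOpen_Iio.preimage hgcont)
  obtain ⟨v, hv⟩ : ∃ v, g v < 0 := by
    obtain ⟨v, hv⟩ := DFunLike.ne_iff.1 hg0
    rcases lt_or_gt_of_ne hv with h | h
    · exact ⟨v, h⟩
    · exact ⟨-v, by simpa using h⟩
  obtain ⟨_, ⟨b, hb, hbk⟩, k, rfl⟩ := hdense.inter_open_nonempty _ hopen ⟨_, v, hv, rfl⟩
  have hbk' : exp b = ∏ i, t i ^ k i := hbk
  have hunit : IsUnit (∏ i, t i ^ k i) := hbk' ▸ isUnit_exp b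
  have hprod : exp (∑ i, k i • l (t i)) = ∏ i, t i ^ k i := by
    rw [exp_sum]
    refine Finset.prod_congr rfl fun i _ => ?_
    rcases Nat.eq_zero_or_pos (k i) with h | h
    · simp [h]
    · have hi : IsUnit (t i ^ k i) := isUnit_of_dvd_unit
        (Finset.dvd_prod_of_mem (fun i => t i ^ k i) (Finset.mem_univ i)) hunit
      rw [exp_nsmul, hl _ ((isUnit_pow_iff h.ne').1 hi)]
  have hker : b + -∑ i, k i • l (t i) ∈ expKernelSpan A := by
    refine Submodule.subset_span ?_
    change exp (b + -∑ i, k i • l (t i)) = 1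
    rw [exp_add, hbk', ← hprod, exp_mul_exp_neg_self]
  have h := hgK _ hker
  have hsum : 0 ≤ g (∑ i, k i • l (t i)) := by
    rw [map_sum]
    exact Finset.sum_nonneg fun i _ => by rw [map_nsmul]; exact nsmul_nonneg (hga i) _
  rw [map_add, map_neg] at h
  have : g b < 0 := hb
  linarith

/-- A commuting tuple of at most `n` operators on `ℂⁿ` is not hypercyclic. -/
theorem not_tupleHypercyclic_of_le {m n : ℕ} (hm : 1 ≤ m) (hmn : m ≤ n)
    (T : Fin m → Module.End ℂ (Fin n → ℂ)) (hT : ∀ i j, Commute (T i) (T j)) :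
    ¬TupleHypercyclic T := by
  rintro ⟨x, hx⟩
  let V := Fin n → ℂ
  let Φ : Module.End ℂ V ≃ₐ[ℂ] (V →L[ℂ] V) := Module.End.toContinuousLinearMap V
  let A := Algebra.adjoin ℂ (Set.range fun i => Φ (T i))
  have hcomm : ∀ a b : A, a * b = b * a := by
    have := Algebra.isMulCommutative_adjoin ℂ (s := Set.range fun i => Φ (T i)) (by
      rintro _ ⟨i, rfl⟩ _ ⟨j, rfl⟩
      exact ((hT i j).map Φ).eq)
    exact fun a b => mul_comm' a b
  let _ : NormedCommRing A := { Subalgebra.normedRing A with mul_comm := hcomm }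
  let _ : NormedAlgebra ℂ A := Subalgebra.toNormedAlgebra A
  let φ : A →ₐ[ℂ] Module.End ℂ V := Φ.symm.toAlgHom.comp A.val
  have hφ : Function.Injective φ := Φ.symm.injective.comp Subtype.val_injective
  have hfin : FiniteDimensional ℂ A := FiniteDimensional.of_injective φ.toLinearMap hφ
  let t : Fin m → A := fun i => ⟨Φ (T i), Algebra.subset_adjoin ⟨i, rfl⟩⟩
  have ht (k : Fin m → ℕ) : φ (∏ i, t i ^ k i) = (List.ofFn fun i => T i ^ k i).prod := by
    rw [← List.prod_ofFn, map_list_prod, List.map_ofFn]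
    congr 2
    funext i
    change φ (t i ^ k i) = _
    rw [map_pow]
    congr 1
  let ev : A →ₗ[ℂ] V := (LinearMap.applyₗ x).comp φ.toLinearMap
  have hev (k : Fin m → ℕ) : ev (∏ i, t i ^ k i) = (List.ofFn fun i => T i ^ k i).prod x := by
    rw [← ht]
    rfl
  have hinj : Function.Injective ev := by
    refine (injective_iff_map_eq_zero ev).2 fun a ha => hφ ?_
    rw [map_zero]
    have hclosed : IsClosed (LinearMap.ker (φ a) : Set V) :=
      Submodule.closed_of_finiteDimensional _
    have hsub : (Set.univ : Set V) ⊆ LinearMap.ker (φ a) := by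
      rw [← hx.closure_eq]
      refine closure_minimal ?_ hclosed
      rintro _ ⟨k, rfl⟩
      change φ a _ = 0
      rw [← ht, ← Module.End.mul_apply, ← map_mul, mul_comm, map_mul, Module.End.mul_apply]
      rw [show φ a x = 0 from ha, map_zero]
    exact LinearMap.ext fun v => hsub (Set.mem_univ v)
  have hsurj : Function.Surjective ev := by
    have hsub : (Set.univ : Set V) ⊆ LinearMap.range ev := by
      rw [← hx.closure_eq]
      refine closure_minimal ?_ (Submodule.closed_of_finiteDimensional _)
      rintro _ ⟨k, rfl⟩
      exact ⟨_, hev k⟩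
    exact fun v => hsub (Set.mem_univ v)
  let e : A ≃ₗ[ℂ] V := LinearEquiv.ofBijective ev ⟨hinj, hsurj⟩
  have hrank : Module.finrank ℂ A = n := by
    rw [e.finrank_eq, Module.finrank_fin_fun]
  have : Nonempty (Fin m) := ⟨⟨0, hm⟩⟩
  refine not_dense_range_prod_pow (by simpa [hrank] using hmn) t ?_
  refine ((e.symm.surjective.denseRange.dense_image
    e.symm.toLinearMap.continuous_of_finiteDimensional) hx).mono ?_
  rintro _ ⟨_, ⟨k, rfl⟩, rfl⟩
  refine ⟨k, ?_⟩
  change _ = e.symm _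
  rw [LinearEquiv.eq_symm_apply]
  exact hev k

/-- A parametrization of the punctured open unit disc. -/
noncomputable def puncturedDiscParam (p : ℝ × ℝ) : ℂ :=
  Complex.exp (-(Real.exp p.1 : ℂ) + p.2 * Complex.I)

theorem continuous_puncturedDiscParam : Continuous puncturedDiscParam := by
  unfold puncturedDiscParam
  fun_prop

theorem tendsto_div_natCast_of_abs_sub_le {u : ℕ → ℝ} {a C : ℝ}
    (h : ∀ᶠ l : ℕ in atTop, |u l - l * a| ≤ C) :
    Tendsto (fun l : ℕ => u l / l) atTop (𝓝 a) := by
  rw [tendsto_iff_dist_tendsto_zero]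
  refine squeeze_zero' (Eventually.of_forall fun _ => dist_nonneg) ?_
    (tendsto_const_div_atTop_nhds_zero_nat C)
  filter_upwards [h, eventually_gt_atTop 0] with l hl hl0
  have hl0 : (0 : ℝ) < l := Nat.cast_pos.2 hl0
  rw [Real.dist_eq, show u l / l - a = (u l - l * a) / l by field_simp, abs_div,
    abs_of_pos hl0]
  gcongr

theorem eventually_exists_puncturedDiscParam_pow_mul (p : ℝ × ℝ) {w : ℂ} (hw : w ≠ 0) {ε : ℝ}
    (hε : 0 < ε) :
    ∀ᶠ l : ℕ in atTop, ∃ q, dist q p < ε ∧ ∃ k : ℕ, puncturedDiscParam q ^ l * 2 ^ k = w := by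
  obtain ⟨s, θ⟩ := p
  have hlog2 : 0 < Real.log 2 := Real.log_pos one_lt_two
  let k : ℕ → ℕ := fun l => ⌈(l * Real.exp s + Real.log ‖w‖) / Real.log 2⌉₊
  let m : ℕ → ℤ := fun l => round ((l * θ - w.arg) / (2 * Real.pi))
  let r : ℕ → ℝ := fun l => (k l * Real.log 2 - Real.log ‖w‖) / l
  let η : ℕ → ℝ := fun l => (w.arg + m l * (2 * Real.pi)) / l
  have hr : Tendsto r atTop (𝓝 (Real.exp s)) := by
    refine tendsto_div_natCast_of_abs_sub_le (C := Real.log 2) ?_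
    have hlim : Tendsto (fun l : ℕ => l * Real.exp s + Real.log ‖w‖) atTop atTop :=
      tendsto_atTop_add_const_right _ _
        (tendsto_natCast_atTop_atTop.atTop_mul_const (Real.exp_pos s))
    filter_upwards [hlim.eventually_ge_atTop 0] with l hl
    have h1 := Nat.le_ceil ((l * Real.exp s + Real.log ‖w‖) / Real.log 2)
    have h2 := Nat.ceil_lt_add_one (div_nonneg hl hlog2.le)
    rw [div_le_iff₀ hlog2] at h1
    rw [← sub_lt_iff_lt_add, lt_div_iff₀ hlog2] at h2
    rw [abs_le]
    constructor <;> simp only [k] <;> linarith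
  have hη : Tendsto η atTop (𝓝 θ) := by
    refine tendsto_div_natCast_of_abs_sub_le (C := Real.pi) (Eventually.of_forall fun l => ?_)
    have h := abs_sub_round ((l * θ - w.arg) / (2 * Real.pi))
    have h2 : w.arg + m l * (2 * Real.pi) - l * θ =
        -((l * θ - w.arg) / (2 * Real.pi) - m l) * (2 * Real.pi) := by
      field_simp
      ring
    rw [h2, abs_mul, abs_neg, abs_of_pos Real.two_pi_pos]
    nlinarith [Real.pi_pos]
  have hlim : Tendsto (fun l => (Real.log (r l), η l)) atTop (𝓝 (s, θ)) := by
    refine Tendsto.prodMk_nhds ?_ hη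
    simpa using hr.log (Real.exp_pos s).ne'
  filter_upwards [hlim.eventually (Metric.ball_mem_nhds _ hε), eventually_gt_atTop 0,
    hr.eventually (lt_mem_nhds (Real.exp_pos s))] with l hl hl0 hrl
  refine ⟨_, hl, k l, ?_⟩
  have hl0 : (l : ℂ) ≠ 0 := Nat.cast_ne_zero.2 hl0.ne'
  have h2 : (2 : ℂ) ^ k l = Complex.exp (k l * Complex.log 2) := by
    rw [Complex.exp_nat_mul, Complex.exp_log two_ne_zero]
  have hlogw : Complex.log w = Real.log ‖w‖ + w.arg * Complex.I := rfl
  have hlog2c : Complex.log 2 = (Real.log 2 : ℝ) := by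
    rw [Complex.ofReal_log zero_le_two, Complex.ofReal_ofNat]
  rw [puncturedDiscParam, Real.exp_log hrl, h2, ← Complex.exp_nat_mul, ← Complex.exp_add]
  conv_rhs => rw [← Complex.exp_log hw, ← Complex.exp_periodic.int_mul (m l)]
  congr 1
  rw [hlogw, hlog2c]
  simp only [r, η]
  push_cast
  field_simp
  ring

theorem exists_dense_range_pow_mul_two_pow (ι : Type*) [Fintype ι] :
    ∃ b : ι → ℂ, Dense {y : ι → ℂ | ∃ (l : ℕ) (k : ι → ℕ), y = fun i => b i ^ l * 2 ^ k i} := by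
  let F : ℕ → (ι → ℕ) → (ι → ℝ × ℝ) → ι → ℂ :=
    fun l k p i => puncturedDiscParam (p i) ^ l * 2 ^ k i
  have hF (l : ℕ) (k : ι → ℕ) : Continuous (F l k) := by
    refine continuous_pi fun i => ?_
    exact ((continuous_puncturedDiscParam.comp (continuous_apply i)).pow l).mul continuous_const
  let B := TopologicalSpace.countableBasis (ι → ℂ)
  have hB : TopologicalSpace.IsTopologicalBasis B :=
    TopologicalSpace.isBasis_countableBasis _
  let G : Set (ι → ℂ) → Set (ι → ℝ × ℝ) := fun U => ⋃ (l : ℕ) (k : ι → ℕ), F l k ⁻¹' U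
  have hopen : ∀ U ∈ B, IsOpen (G U) := fun U hU =>
    isOpen_iUnion fun l => isOpen_iUnion fun k => (hB.isOpen hU).preimage (hF l k)
  have hdense : ∀ U ∈ B, Dense (G U) := by
    intro U hU
    have hne : U.Nonempty := TopologicalSpace.nonempty_of_mem_countableBasis hU
    obtain ⟨z, hzU, hz⟩ := (dense_pi (Set.univ : Set ι)
      fun _ _ => dense_compl_singleton (0 : ℂ)).inter_open_nonempty U (hB.isOpen hU) hne
    refine Metric.dense_iff.2 fun p ε hε => ?_
    obtain ⟨l, hl⟩ := (eventually_all.2 fun i =>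
      eventually_exists_puncturedDiscParam_pow_mul (p i) (hz i (Set.mem_univ i)) hε).exists
    choose q hq k hk using hl
    refine ⟨q, (dist_pi_lt_iff hε).2 hq, Set.mem_iUnion₂.2 ⟨l, k, ?_⟩⟩
    rwa [Set.mem_preimage, show F l k q = z from funext hk]
  obtain ⟨p, hp⟩ := (dense_biInter_of_isOpen hopen
    (TopologicalSpace.countable_countableBasis _) hdense).nonempty
  refine ⟨fun i => puncturedDiscParam (p i), hB.dense_iff.2 fun U hU _ => ?_⟩
  obtain ⟨l, k, h⟩ := Set.mem_iUnion₂.1 (Set.mem_iInter₂.1 hp U hU)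
  exact ⟨_, h, l, k, rfl⟩

theorem exists_commute_tupleHypercyclic (n : ℕ) :
    ∃ T : Fin (n + 1) → Module.End ℂ (Fin n → ℂ),
      (∀ i j, Commute (T i) (T j)) ∧ TupleHypercyclic T := by
  obtain ⟨b, hb⟩ := exists_dense_range_pow_mul_two_pow (Fin n)
  let c : Fin (n + 1) → Fin n → ℂ := Fin.cons b fun j => Pi.mulSingle j 2
  refine ⟨fun i => Algebra.lmul ℂ (Fin n → ℂ) (c i),
    fun i j => (Commute.all (c i) (c j)).map _, 1, hb.mono ?_⟩
  rintro _ ⟨l, k, rfl⟩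
  refine ⟨Fin.cons l k, ?_⟩
  have h (K : Fin (n + 1) → ℕ) : (List.ofFn fun i => Algebra.lmul ℂ (Fin n → ℂ) (c i) ^ K i).prod =
      Algebra.lmul ℂ (Fin n → ℂ) (∏ i, c i ^ K i) := by
    rw [← List.prod_ofFn, map_list_prod, List.map_ofFn]
    simp only [Function.comp_def, map_pow]
  rw [h, Fin.prod_univ_succ]
  funext i
  simp [c, Finset.prod_apply, Pi.mulSingle_apply, Finset.prod_ite_eq, ite_pow]

/-- Feldman/Shkarin: the minimal cardinality of a hypercyclic tuple of pairwise commuting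
linear operators on `ℂⁿ` is `n + 1`: there is a hypercyclic commuting `(n+1)`-tuple, and
no commuting `n`-tuple is hypercyclic. -/
theorem minimal_hypercyclic_tuple_complex (n : ℕ) (hn : 1 ≤ n) :
    (∃ T : Fin (n + 1) → Module.End ℂ (Fin n → ℂ),
      (∀ i j, Commute (T i) (T j)) ∧ TupleHypercyclic T) ∧
    (∀ T : Fin n → Module.End ℂ (Fin n → ℂ),
      (∀ i j, Commute (T i) (T j)) → ¬TupleHypercyclic T) :=
  ⟨exists_commute_tupleHypercyclic n, not_tupleHypercyclic_of_le hn le_rfl⟩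
end
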